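/- arXiv:1108.0908 — 8 statements merged into one kernel-verified Lean document; each statement's English description precedes it below -/
import Mathlib

section
/- Let n ≥ 2. Every rank-3 element of the Lorentzian spin factor, i.e. every A ∈ ℝ × ℝⁿ with N(A) ≠ 0, is Str₀-related to a canonical form (ε; ½(1+k), ½(1−k), 0, …, 0) for some ε ∈ {1, −1} and some nonzero k ∈ ℝ with ε·k = N(A). -/
open Real Matrix

/-- The underlying vector space of the spin factor `J_{1,n-1} = ℝ ⊕ Γ_{1,n-1}`. -/
abbrev J (n : ℕ) : Type := ℝ × (Fin n → ℝ)

/-- The Lorentzian quadratic form `Q(v) = v₀² - v₁² - ⋯ - v_{n-1}²`. -/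
noncomputable def Qf {n : ℕ} (v : Fin n → ℝ) : ℝ :=
  ∑ i : Fin n, (if (i : ℕ) = 0 then (1 : ℝ) else -1) * v i ^ 2

/-- The cubic norm `N(a; v) = a Q(v)`. -/
noncomputable def Nrm {n : ℕ} (A : J n) : ℝ := A.1 * Qf A.2

/-- The quadratic adjoint `A♯ = (Q(v); a v₀, -a v₁, …, -a v_{n-1})`. -/
noncomputable def sharp {n : ℕ} (A : J n) : J n :=
  (Qf A.2, fun i => if (i : ℕ) = 0 then A.1 * A.2 i else -(A.1 * A.2 i))

/-- The vector with first two coordinates `x, y` and all other coordinates zero. -/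
def vec2 {n : ℕ} (x y : ℝ) : Fin n → ℝ :=
  fun i => if (i : ℕ) = 0 then x else if (i : ℕ) = 1 then y else 0

/-- The Lorentzian metric `η = diag(1, -1, …, -1)`. -/
noncomputable def eta (n : ℕ) : Matrix (Fin n) (Fin n) ℝ :=
  Matrix.diagonal fun i => if (i : ℕ) = 0 then 1 else -1

/-- `Str₀`-relatedness: `B = (e^{2λ} a; e^{-λ} Λ v)` for some `λ ∈ ℝ` and
`Λ ∈ SO(1, n-1)`, i.e. `Λᵀ η Λ = η` and `det Λ = 1`. -/
def StrRel {n : ℕ} (A B : J n) : Prop :=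
  ∃ (l : ℝ) (Λ : Matrix (Fin n) (Fin n) ℝ),
    Λᵀ * eta n * Λ = eta n ∧ Λ.det = 1 ∧
      B = (Real.exp (2 * l) * A.1, fun i => Real.exp (-l) * Λ.mulVec A.2 i)

section Reflection

variable {ι : Type*} [Fintype ι]

theorem dotProduct_mulVec_symm {S : Matrix ι ι ℝ} (hS : Sᵀ = S) (x y : ι → ℝ) :
    x ⬝ᵥ S *ᵥ y = y ⬝ᵥ S *ᵥ x := by
  rw [dotProduct_mulVec, ← mulVec_transpose, hS, dotProduct_comm]

variable [DecidableEq ι]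

/-- The reflection `y ↦ y - 2 (S(x, y) / S(x, x)) x` along `x` for the bilinear form with Gram
matrix `S`. -/
noncomputable def formReflection (S : Matrix ι ι ℝ) (x : ι → ℝ) : Matrix ι ι ℝ :=
  1 - vecMulVec ((2 / (x ⬝ᵥ S *ᵥ x)) • x) (S *ᵥ x)

theorem formReflection_mulVec (S : Matrix ι ι ℝ) (x y : ι → ℝ) :
    formReflection S x *ᵥ y = y - ((2 / (x ⬝ᵥ S *ᵥ x)) * ((S *ᵥ x) ⬝ᵥ y)) • x := by
  rw [formReflection, sub_mulVec, one_mulVec, vecMulVec_mulVec]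
  ext i
  simp only [Pi.sub_apply, Pi.smul_apply, MulOpposite.smul_eq_mul_unop, MulOpposite.unop_op,
    smul_eq_mul]
  ring

theorem det_formReflection {S : Matrix ι ι ℝ} {x : ι → ℝ} (hx : x ⬝ᵥ S *ᵥ x ≠ 0) :
    (formReflection S x).det = -1 := by
  have h : formReflection S x =
      1 + replicateCol Unit (-((2 / (x ⬝ᵥ S *ᵥ x)) • x)) * replicateRow Unit (S *ᵥ x) := by
    rw [← vecMulVec_eq, formReflection, neg_vecMulVec, sub_eq_add_neg]
  rw [h, det_one_add_replicateCol_mul_replicateRow, dotProduct_neg, dotProduct_smul,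
    dotProduct_comm (S *ᵥ x), smul_eq_mul, div_mul_cancel₀ _ hx]
  norm_num

theorem transpose_formReflection_mul_mul {S : Matrix ι ι ℝ} (hS : Sᵀ = S) {x : ι → ℝ}
    (hx : x ⬝ᵥ S *ᵥ x ≠ 0) : (formReflection S x)ᵀ * S * formReflection S x = S := by
  have hv : x ᵥ* S = S *ᵥ x := by rw [← mulVec_transpose, hS]
  have hc : 2 / (x ⬝ᵥ S *ᵥ x) * (x ⬝ᵥ S *ᵥ x) = 2 := div_mul_cancel₀ _ hx
  have ht : (formReflection S x)ᵀ * S =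
      S - (2 / (x ⬝ᵥ S *ᵥ x)) • vecMulVec (S *ᵥ x) (S *ᵥ x) := by
    rw [formReflection, transpose_sub, transpose_one, transpose_vecMulVec, Matrix.sub_mul,
      Matrix.one_mul, vecMulVec_mul, smul_vecMul, hv, vecMulVec_smul]
  rw [ht, formReflection, Matrix.mul_sub, Matrix.mul_one, mul_vecMulVec, mulVec_smul, sub_mulVec,
    smul_mulVec, vecMulVec_mulVec, dotProduct_comm (S *ᵥ x)]
  ext i j
  simp only [Matrix.sub_apply, Matrix.smul_apply, vecMulVec_apply, Pi.smul_apply, Pi.sub_apply,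
    smul_eq_mul, MulOpposite.smul_eq_mul_unop, MulOpposite.unop_op]
  linear_combination (2 / (x ⬝ᵥ S *ᵥ x)) * (S *ᵥ x) i * (S *ᵥ x) j * hc

theorem formReflection_sub_mulVec {S : Matrix ι ι ℝ} (hS : Sᵀ = S) {v w : ι → ℝ}
    (hvw : v ⬝ᵥ S *ᵥ v = w ⬝ᵥ S *ᵥ w) (h : (v - w) ⬝ᵥ S *ᵥ (v - w) ≠ 0) :
    formReflection S (v - w) *ᵥ v = w := by
  have hc : 2 / ((v - w) ⬝ᵥ S *ᵥ (v - w)) * ((S *ᵥ (v - w)) ⬝ᵥ v) = 1 := by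
    rw [div_mul_eq_mul_div, div_eq_one_iff_eq h, dotProduct_comm]
    simp only [mulVec_sub, sub_dotProduct, dotProduct_sub]
    linear_combination hvw - dotProduct_mulVec_symm hS v w
  rw [formReflection_mulVec, hc, one_smul, sub_sub_cancel]

theorem formReflection_mulVec_of_orthogonal {S : Matrix ι ι ℝ} {x y : ι → ℝ}
    (h : (S *ᵥ x) ⬝ᵥ y = 0) : formReflection S x *ᵥ y = y := by
  simp [formReflection_mulVec, h]

/-- Two vectors of the same nonzero norm are related by a product of two reflections, provided
the target has an anisotropic orthogonal vector. -/
theorem exists_isometry_det_one_mulVec_eq {S : Matrix ι ι ℝ} (hS : Sᵀ = S) {v w x : ι → ℝ}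
    (hvw : v ⬝ᵥ S *ᵥ v = w ⬝ᵥ S *ᵥ w) (hw : w ⬝ᵥ S *ᵥ w ≠ 0)
    (hx : x ⬝ᵥ S *ᵥ x ≠ 0) (hxw : (S *ᵥ x) ⬝ᵥ w = 0) :
    ∃ L : Matrix ι ι ℝ, Lᵀ * S * L = S ∧ L.det = 1 ∧ L *ᵥ v = w := by
  have key : ∀ y z : ι → ℝ, y ⬝ᵥ S *ᵥ y ≠ 0 → z ⬝ᵥ S *ᵥ z ≠ 0 →
      formReflection S y *ᵥ (formReflection S z *ᵥ v) = w →
      ∃ L : Matrix ι ι ℝ, Lᵀ * S * L = S ∧ L.det = 1 ∧ L *ᵥ v = w := by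
    intro y z hy hz hyz
    refine ⟨formReflection S y * formReflection S z, ?_, ?_, ?_⟩
    · calc _ = (formReflection S z)ᵀ * ((formReflection S y)ᵀ * S * formReflection S y) *
            formReflection S z := by simp only [transpose_mul, Matrix.mul_assoc]
        _ = S := by
          rw [transpose_formReflection_mul_mul hS hy, transpose_formReflection_mul_mul hS hz]
    · rw [det_mul, det_formReflection hy, det_formReflection hz]
      norm_num
    · rw [← mulVec_mulVec, hyz]
  by_cases h : (v - w) ⬝ᵥ S *ᵥ (v - w) = 0
  · have h' : (v - -w) ⬝ᵥ S *ᵥ (v - -w) ≠ 0 := by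
      intro h0
      simp only [mulVec_sub, sub_dotProduct, dotProduct_sub, mulVec_neg, neg_dotProduct,
        dotProduct_neg] at h h0
      exact hw (by linear_combination (h + h0) / 4 - hvw / 2)
    refine key w (v - -w) hw h' ?_
    rw [formReflection_sub_mulVec hS (by simpa [mulVec_neg] using hvw) h', mulVec_neg,
      formReflection_mulVec, dotProduct_comm (S *ᵥ w), div_mul_cancel₀ _ hw]
    module
  · refine key x (v - w) hx h ?_
    rw [formReflection_sub_mulVec hS hvw h, formReflection_mulVec_of_orthogonal hxw]

end Reflection

theorem eta_transpose (n : ℕ) : (eta n)ᵀ = eta n := diagonal_transpose _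

theorem dotProduct_eta_mulVec_self {n : ℕ} (v : Fin n → ℝ) : v ⬝ᵥ eta n *ᵥ v = Qf v := by
  simp only [dotProduct, eta, mulVec_diagonal, Qf]
  exact Finset.sum_congr rfl fun i _ => by ring

theorem Qf_smul {n : ℕ} (c : ℝ) (v : Fin n → ℝ) : Qf (c • v) = c ^ 2 * Qf v := by
  rw [← dotProduct_eta_mulVec_self, ← dotProduct_eta_mulVec_self, mulVec_smul, smul_dotProduct,
    dotProduct_smul, smul_eq_mul, smul_eq_mul]
  ring

theorem eta_mulVec_vec2_dotProduct {n : ℕ} (hn : 2 ≤ n) (x y x' y' : ℝ) :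
    (eta n *ᵥ vec2 x y) ⬝ᵥ vec2 x' y' = x * x' - y * y' := by
  obtain ⟨m, rfl⟩ := Nat.exists_eq_add_of_le' hn
  simp [dotProduct, eta, mulVec_diagonal, vec2, Fin.sum_univ_succ]
  ring

theorem Qf_vec2 {n : ℕ} (hn : 2 ≤ n) (x y : ℝ) :
    Qf (vec2 x y : Fin n → ℝ) = x ^ 2 - y ^ 2 := by
  rw [← dotProduct_eta_mulVec_self, dotProduct_comm, eta_mulVec_vec2_dotProduct hn]
  ring

/-- every rank-3 element of the Lorentzian spin factor (`N(A) ≠ 0`)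
is `Str₀`-related to `(ε; ½(1+k), ½(1-k))` with `ε ∈ {1, -1}`, `k ≠ 0` and `ε k = N(A)`. -/
theorem spin_factor_rank3_orbits (n : ℕ) (hn : 2 ≤ n) (A : J n) (h : Nrm A ≠ 0) :
    ∃ ε k : ℝ, (ε = 1 ∨ ε = -1) ∧ k ≠ 0 ∧ ε * k = Nrm A ∧
      StrRel A (ε, vec2 ((1 + k) / 2) ((1 - k) / 2)) := by
  obtain ⟨a, v⟩ := A
  obtain ⟨ha, hv⟩ : a ≠ 0 ∧ Qf v ≠ 0 := mul_ne_zero_iff.mp h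
  have ha' : 0 < |a| := abs_pos.mpr ha
  obtain ⟨ε, hε, hεa⟩ : ∃ ε : ℝ, (ε = 1 ∨ ε = -1) ∧ a = ε * |a| := by
    rcases abs_choice a with h1 | h1
    · exact ⟨1, Or.inl rfl, by rw [h1, one_mul]⟩
    · exact ⟨-1, Or.inr rfl, by rw [h1]; ring⟩
  set l : ℝ := -(Real.log |a| / 2) with hl
  have h2l : Real.exp (2 * l) * |a| = 1 := by
    rw [show 2 * l = -Real.log |a| by rw [hl]; ring, Real.exp_neg, Real.exp_log ha',
      inv_mul_cancel₀ ha'.ne']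
  have hnl : Real.exp (-l) ^ 2 = |a| := by
    rw [← Real.exp_nat_mul, show ((2 : ℕ) : ℝ) * -l = Real.log |a| by rw [hl]; push_cast; ring,
      Real.exp_log ha']
  set k : ℝ := |a| * Qf v with hk
  have hk0 : k ≠ 0 := mul_ne_zero ha'.ne' hv
  set w : Fin n → ℝ := vec2 ((1 + k) / 2) ((1 - k) / 2) with hw
  have hQw : Qf w = k := by rw [hw, Qf_vec2 hn]; ring
  obtain ⟨L, hLη, hLdet, hLv⟩ := exists_isometry_det_one_mulVec_eq (eta_transpose n)
    (v := Real.exp (-l) • v) (w := w) (x := vec2 ((1 - k) / 2) ((1 + k) / 2))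
    (by rw [dotProduct_eta_mulVec_self, dotProduct_eta_mulVec_self, Qf_smul, hnl, hQw])
    (by rwa [dotProduct_eta_mulVec_self, hQw])
    (by
      rw [dotProduct_eta_mulVec_self, Qf_vec2 hn]
      intro h0
      exact hk0 (by linear_combination -h0))
    (by rw [hw, eta_mulVec_vec2_dotProduct hn]; ring)
  refine ⟨ε, k, hε, hk0, ?_, l, L, hLη, hLdet, Prod.ext ?_ ?_⟩
  · simp only [Nrm]
    linear_combination (-Qf v) * hεa
  · simp only
    linear_combination (-Real.exp (2 * l)) * hεa - ε * h2l
  · exact hLv.symm.trans (mulVec_smul L _ v)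
end

section
/- In the Freudenthal triple system F_ℝ, rank 2 implies rank 1: for every x ∈ F_ℝ, if T(x) = 0 then Υ(x, y) = 0 for all y ∈ F_ℝ. In particular F_ℝ contains no rank-2 elements. -/
open Real

/-- The Freudenthal triple system `F_ℝ = ℝ⁴`, with elements `x = (α, β, A, B)`. -/
abbrev FR : Type := ℝ × ℝ × ℝ × ℝ

/-- The antisymmetric bilinear form `{x, y} = αδ - βγ + 3(AD - BC)`. -/
noncomputable def sympR (x y : FR) : ℝ :=
  x.1 * y.2.1 - x.2.1 * y.1 + 3 * (x.2.2.1 * y.2.2.2 - x.2.2.2 * y.2.2.1)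

/-- The quartic form `Δ(x) = -(αβ - 3AB)² - 4(α A³ + β B³ - 3A²B²)`. -/
noncomputable def DltR (x : FR) : ℝ :=
  -(x.1 * x.2.1 - 3 * x.2.2.1 * x.2.2.2) ^ 2
    - 4 * (x.1 * x.2.2.1 ^ 3 + x.2.1 * x.2.2.2 ^ 3 - 3 * x.2.2.1 ^ 2 * x.2.2.2 ^ 2)

/-- The binary cubic form `p_x(u, v) = α u³ + 3B u²v + 3A uv² + β v³` attached to
`x = (α, β, A, B) ∈ F_ℝ`. -/
noncomputable def cub (x : FR) (u v : ℝ) : ℝ :=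
  x.1 * u ^ 3 + 3 * x.2.2.2 * u ^ 2 * v + 3 * x.2.2.1 * u * v ^ 2 + x.2.1 * v ^ 3

/-- `SL(2,ℝ)`-relatedness: `y = M·x` for some `M = [[a,b],[c,d]] ∈ SL(2,ℝ)`, i.e.
`p_y(u, v) = p_x(au + cv, bu + dv)` for all `u, v`. -/
def SLRel (x y : FR) : Prop :=
  ∃ a b c d : ℝ, a * d - b * c = 1 ∧
    ∀ u v : ℝ, cub y u v = cub x (a * u + c * v) (b * u + d * v)

/-- `T` is the triple-product map: `{T(x), z} = ½ (d/ds)|₀ Δ(x + s z)` for all `x, z`. -/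
def IsTripleMapR (T : FR → FR) : Prop :=
  ∀ x z, sympR (T x) z = (1 / 2) * deriv (fun s : ℝ => DltR (x + s • z)) 0

/-- `Υ(x, y) = (d/ds)|₀ T(x + s y) + {x, y} x`. -/
noncomputable def UpsR (T : FR → FR) (x y : FR) : FR :=
  deriv (fun s : ℝ => T (x + s • y)) 0 + sympR x y • x

/-- The explicit coordinate formula for the triple-product map. -/
noncomputable def tripleFormula (x : FR) : FR :=
  (-x.1 ^ 2 * x.2.1 + 3 * x.1 * x.2.2.2 * x.2.2.1 - 2 * x.2.2.2 ^ 3,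
    x.1 * x.2.1 ^ 2 - 3 * x.2.2.2 * x.2.2.1 * x.2.1 + 2 * x.2.2.1 ^ 3,
    x.1 * x.2.2.1 * x.2.1 + x.2.2.2 * x.2.2.1 ^ 2 - 2 * x.2.2.2 ^ 2 * x.2.1,
    -x.1 * x.2.2.2 * x.2.1 - x.2.2.2 ^ 2 * x.2.2.1 + 2 * x.1 * x.2.2.1 ^ 2)

theorem hasDerivAt_add_mul_zero (a b : ℝ) : HasDerivAt (fun s : ℝ => a + s * b) b 0 := by
  simpa using ((hasDerivAt_id (0 : ℝ)).mul_const b).const_add a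

theorem hasDerivAt_DltR_line (x z : FR) :
    HasDerivAt (fun s : ℝ => DltR (x + s • z)) (2 * sympR (tripleFormula x) z) 0 := by
  obtain ⟨a, d, c, b⟩ := x
  obtain ⟨a', d', c', b'⟩ := z
  have ha := hasDerivAt_add_mul_zero a a'
  have hb := hasDerivAt_add_mul_zero b b'
  have hc := hasDerivAt_add_mul_zero c c'
  have hd := hasDerivAt_add_mul_zero d d'
  have h := (((ha.mul hd).sub ((hc.const_mul 3).mul hb)).pow 2).neg.sub
    ((((ha.mul (hc.pow 3)).add (hd.mul (hb.pow 3))).sub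
      (((hc.pow 2).const_mul 3).mul (hb.pow 2))).const_mul 4)
  refine h.congr_deriv ?_
  simp [sympR, tripleFormula]
  ring

theorem sympR_ext {p q : FR} (h : ∀ z, sympR p z = sympR q z) : p = q := by
  have h₁ := h (0, 1, 0, 0)
  have h₂ := h (1, 0, 0, 0)
  have h₃ := h (0, 0, 0, 1)
  have h₄ := h (0, 0, 1, 0)
  simp [sympR] at h₁ h₂ h₃ h₄
  exact Prod.ext h₁ (Prod.ext h₂ (Prod.ext h₃ h₄))

theorem IsTripleMapR.eq_tripleFormula {T : FR → FR} (hT : IsTripleMapR T) :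
    T = tripleFormula := by
  funext x
  refine sympR_ext fun z => ?_
  rw [hT, (hasDerivAt_DltR_line x z).deriv]
  ring

/-- If the triple product vanishes, so do the coefficients of the Hessian of the cubic. -/
theorem hessian_eq_zero_of_tripleFormula_eq_zero {a d c b : ℝ}
    (h : tripleFormula (a, d, c, b) = 0) :
    a * c - b ^ 2 = 0 ∧ a * d - b * c = 0 ∧ b * d - c ^ 2 = 0 := by
  simp only [tripleFormula, Prod.mk_eq_zero] at h
  obtain ⟨h₁, h₂, h₃, h₄⟩ := h
  have hac : a * c - b ^ 2 = 0 :=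
    pow_eq_zero_iff two_ne_zero |>.mp <| by linear_combination (a * h₄ - b * h₁) / 2
  have hbd : b * d - c ^ 2 = 0 :=
    pow_eq_zero_iff two_ne_zero |>.mp <| by linear_combination (c * h₂ - d * h₃) / 2
  refine ⟨hac, pow_eq_zero_iff two_ne_zero |>.mp ?_, hbd⟩
  linear_combination (-d * h₁ + a * h₂ - 3 * b * h₃ + 3 * c * h₄) / 2 +
    4 * (b * d - c ^ 2) * hac

theorem hasDerivAt_tripleFormula_line {x : FR} (hx : tripleFormula x = 0) (y : FR) :
    HasDerivAt (fun s : ℝ => tripleFormula (x + s • y)) (-(sympR x y • x)) 0 := by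
  obtain ⟨a, d, c, b⟩ := x
  obtain ⟨a', d', c', b'⟩ := y
  obtain ⟨h₁, h₂, h₃⟩ := hessian_eq_zero_of_tripleFormula_eq_zero hx
  have ha := hasDerivAt_add_mul_zero a a'
  have hb := hasDerivAt_add_mul_zero b b'
  have hc := hasDerivAt_add_mul_zero c c'
  have hd := hasDerivAt_add_mul_zero d d'
  refine HasDerivAt.prodMk (f₁' := -(sympR (a, d, c, b) (a', d', c', b') * a)) ?_
    (HasDerivAt.prodMk (f₁' := -(sympR (a, d, c, b) (a', d', c', b') * d)) ?_
    (HasDerivAt.prodMk (f₁' := -(sympR (a, d, c, b) (a', d', c', b') * c))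
      (f₂' := -(sympR (a, d, c, b) (a', d', c', b') * b)) ?_ ?_))
  · refine ((((ha.pow 2).neg.mul hd).add (((ha.const_mul 3).mul hb).mul hc)).sub
      ((hb.pow 3).const_mul 2)).congr_deriv ?_
    simp [sympR]
    linear_combination (-3 * a') * h₂ + 6 * b' * h₁
  · refine (((ha.mul (hd.pow 2)).sub (((hb.const_mul 3).mul hc).mul hd)).add
      ((hc.pow 3).const_mul 2)).congr_deriv ?_
    simp [sympR]
    linear_combination 3 * d' * h₂ - 6 * c' * h₃
  · refine ((((ha.mul hc).mul hd).add (hb.mul (hc.pow 2))).sub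
      (((hb.pow 2).const_mul 2).mul hd)).congr_deriv ?_
    simp [sympR]
    linear_combination c' * h₂ + 2 * d' * h₁ - 4 * b' * h₃
  · refine ((((ha.neg.mul hb).mul hd).sub ((hb.pow 2).mul hc)).add
      ((ha.const_mul 2).mul (hc.pow 2))).congr_deriv ?_
    simp [sympR]
    linear_combination -2 * a' * h₃ - b' * h₂ + 4 * c' * h₁

/-- in `F_ℝ`, rank 2 implies rank 1: if `T(x) = 0` then `Υ(x, y) = 0` for
every `y`; in particular `F_ℝ` has no rank-2 elements. -/
theorem fr_rank2_implies_rank1 (T : FR → FR) (hT : IsTripleMapR T)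
    (x : FR) (hx : T x = 0) : ∀ y, UpsR T x y = 0 := by
  intro y
  obtain rfl := hT.eq_tripleFormula
  rw [UpsR, (hasDerivAt_tripleFormula_line hx y).deriv, neg_add_cancel]
end

section
/- Let n ≥ 2. Every nonzero element of F^{2,n} is Aut-related to a reduced element of the form (1, β, A, 0) for some β ∈ ℝ and A ∈ J. -/
open Real Matrix

/-- The trace bilinear form `Tr(A,B) = ab + 2(a₀b₀ + ⋯ + a_{n-1}b_{n-1})`. -/
noncomputable def TrF {n : ℕ} (A B : J n) : ℝ :=
  A.1 * B.1 + 2 * ∑ i : Fin n, A.2 i * B.2 i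

/-- The Freudenthal triple system `F^{2,n} = ℝ ⊕ ℝ ⊕ J ⊕ J`, with elements `(α, β, A, B)`. -/
abbrev F (n : ℕ) : Type := ℝ × ℝ × J n × J n

/-- The antisymmetric bilinear form `{x, y} = αδ - βγ + Tr(A,D) - Tr(B,C)`. -/
noncomputable def symp {n : ℕ} (x y : F n) : ℝ :=
  x.1 * y.2.1 - x.2.1 * y.1 + TrF x.2.2.1 y.2.2.2 - TrF x.2.2.2 y.2.2.1

/-- The quartic form
`Δ(x) = -(αβ - Tr(A,B))² - 4(α N(A) + β N(B) - Tr(A♯, B♯))`. -/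
noncomputable def Dlt {n : ℕ} (x : F n) : ℝ :=
  -(x.1 * x.2.1 - TrF x.2.2.1 x.2.2.2) ^ 2
    - 4 * (x.1 * Nrm x.2.2.1 + x.2.1 * Nrm x.2.2.2 - TrF (sharp x.2.2.1) (sharp x.2.2.2))

/-- Membership in `Aut(F^{2,n})`: an invertible `ℝ`-linear map preserving `{,}` and `Δ`. -/
def IsAut {n : ℕ} (σ : F n → F n) : Prop :=
  Function.Bijective σ ∧ IsLinearMap ℝ σ ∧
    (∀ x y, symp (σ x) (σ y) = symp x y) ∧ ∀ x, Dlt (σ x) = Dlt x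

/-- `Aut`-relatedness of two elements of `F^{2,n}`. -/
def AutRel {n : ℕ} (x y : F n) : Prop := ∃ σ, IsAut σ ∧ σ x = y

/-- `T` is the triple-product map: `{T(x), z} = ½ (d/ds)|₀ Δ(x + s z)` for all `x, z`. -/
def IsTripleMap {n : ℕ} (T : F n → F n) : Prop :=
  ∀ x z, symp (T x) z = (1 / 2) * deriv (fun s : ℝ => Dlt (x + s • z)) 0

/-- `Υ(x, y) = (d/ds)|₀ T(x + s y) + {x, y} x`. -/
noncomputable def Ups {n : ℕ} (T : F n → F n) (x y : F n) : F n :=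
  deriv (fun s : ℝ => T (x + s • y)) 0 + symp x y • x

namespace FTS

variable {n : ℕ}

/-- The diagonal entries of the Lorentzian metric. -/
def sgn (i : Fin n) : ℝ := if (i : ℕ) = 0 then 1 else -1

lemma sgn_mul_self (i : Fin n) : sgn i * sgn i = 1 := by
  unfold sgn; split_ifs <;> norm_num

/-- The Lorentzian bilinear form polarizing `Qf`. -/
noncomputable def lor (n : ℕ) : LinearMap.BilinForm ℝ (Fin n → ℝ) :=
  LinearMap.mk₂ ℝ (fun v w => ∑ i, sgn i * v i * w i)
    (fun _ _ _ => by simp only [Pi.add_apply, mul_add, add_mul, Finset.sum_add_distrib])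
    (fun _ _ _ => by
      simp only [Pi.smul_apply, smul_eq_mul, Finset.mul_sum]
      exact Finset.sum_congr rfl fun _ _ => by ring)
    (fun _ _ _ => by simp only [Pi.add_apply, mul_add, Finset.sum_add_distrib])
    (fun _ _ _ => by
      simp only [Pi.smul_apply, smul_eq_mul, Finset.mul_sum]
      exact Finset.sum_congr rfl fun _ _ => by ring)

lemma lor_apply (v w : Fin n → ℝ) : lor n v w = ∑ i, sgn i * v i * w i := rfl

lemma lor_comm (v w : Fin n → ℝ) : lor n v w = lor n w v := by
  simp only [lor_apply]
  exact Finset.sum_congr rfl fun _ _ => by ring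

lemma Qf_eq_lor (v : Fin n → ℝ) : Qf v = lor n v v := by
  simp only [lor_apply, Qf, sgn]
  exact Finset.sum_congr rfl fun _ _ => by ring

lemma sum_sgn_mul_mul (v w : Fin n → ℝ) : ∑ i, v i * (sgn i * w i) = lor n v w := by
  simp only [lor_apply]
  exact Finset.sum_congr rfl fun _ _ => by ring

lemma exists_lor_ne_zero {v : Fin n → ℝ} (hv : v ≠ 0) : ∃ w, lor n v w ≠ 0 := by
  refine ⟨fun i => sgn i * v i, fun h => hv ?_⟩
  have h' : v ⬝ᵥ v = 0 := by
    rw [← h, lor_apply]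
    exact Finset.sum_congr rfl fun i _ => by linear_combination (-(v i * v i)) * sgn_mul_self i
  exact dotProduct_self_eq_zero.mp h'

/-- The vector representation: a hyperbolic plane plus the negated Lorentzian space. -/
abbrev Vec (n : ℕ) : Type := ℝ × ℝ × (Fin n → ℝ)

/-- The bilinear form `x y' + y x' - 2 ⟨v, v'⟩` on `Vec n`. -/
noncomputable def hyp (n : ℕ) : LinearMap.BilinForm ℝ (Vec n) :=
  LinearMap.mk₂ ℝ (fun P Q => P.1 * Q.2.1 + P.2.1 * Q.1 - 2 * lor n P.2.2 Q.2.2)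
    (fun _ _ _ => by simp only [Prod.fst_add, Prod.snd_add, map_add, LinearMap.add_apply]; ring)
    (fun _ _ _ => by
      simp only [Prod.smul_fst, Prod.smul_snd, map_smul, LinearMap.smul_apply, smul_eq_mul]; ring)
    (fun _ _ _ => by simp only [Prod.fst_add, Prod.snd_add, map_add]; ring)
    (fun _ _ _ => by simp only [Prod.smul_fst, Prod.smul_snd, map_smul, smul_eq_mul]; ring)

lemma hyp_apply (P Q : Vec n) :
    hyp n P Q = P.1 * Q.2.1 + P.2.1 * Q.1 - 2 * lor n P.2.2 Q.2.2 := rfl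

lemma hyp_comm (P Q : Vec n) : hyp n P Q = hyp n Q P := by
  rw [hyp_apply, hyp_apply, lor_comm]; ring

/-- The identification of `F n` with pairs of vectors. -/
noncomputable def pairEquiv (n : ℕ) : F n ≃ₗ[ℝ] Vec n × Vec n where
  toFun x := ((x.1, x.2.2.1.1, fun i => sgn i * x.2.2.2.2 i), (x.2.2.2.1, x.2.1, x.2.2.1.2))
  invFun p := (p.1.1, p.2.2.1, (p.1.2.1, p.2.2.2), (p.2.1, fun i => sgn i * p.1.2.2 i))
  map_add' x y := by ext <;> simp [mul_add]
  map_smul' c x := by ext <;> simp [mul_left_comm]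
  left_inv x := by ext <;> simp [← mul_assoc, sgn_mul_self]
  right_inv p := by ext <;> simp [← mul_assoc, sgn_mul_self]

lemma pairEquiv_symm_apply (p : Vec n × Vec n) : (pairEquiv n).symm p =
    (p.1.1, p.2.2.1, (p.1.2.1, p.2.2.2), (p.2.1, fun i => sgn i * p.1.2.2 i)) := rfl

lemma symp_pairEquiv_symm (p p' : Vec n × Vec n) :
    symp ((pairEquiv n).symm p) ((pairEquiv n).symm p') =
      hyp n p.1 p'.2 - hyp n p.2 p'.1 := by
  simp only [pairEquiv_symm_apply, symp, TrF, hyp_apply, sum_sgn_mul_mul]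
  have h : ∑ i, sgn i * p.1.2.2 i * p'.2.2.2 i = lor n p.1.2.2 p'.2.2.2 := rfl
  rw [h]; ring

lemma Qf_sgn_mul (v : Fin n → ℝ) : Qf (fun i => sgn i * v i) = lor n v v := by
  rw [Qf_eq_lor, lor_apply, lor_apply]
  exact Finset.sum_congr rfl fun i _ => by
    linear_combination (sgn i * v i * v i) * sgn_mul_self i

lemma sharp_eq (A : J n) : sharp A = (Qf A.2, fun i => sgn i * (A.1 * A.2 i)) := by
  refine Prod.ext rfl (funext fun i => ?_)
  simp only [sharp, sgn]; split_ifs <;> ring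

lemma Dlt_pairEquiv_symm (p : Vec n × Vec n) :
    Dlt ((pairEquiv n).symm p) = hyp n p.1 p.1 * hyp n p.2 p.2 - hyp n p.1 p.2 ^ 2 := by
  have h : ∑ i, sgn i * (p.1.2.1 * p.2.2.2 i) * (sgn i * (p.2.1 * (sgn i * p.1.2.2 i))) =
      p.1.2.1 * p.2.1 * lor n p.1.2.2 p.2.2.2 := by
    rw [lor_apply, Finset.mul_sum]
    exact Finset.sum_congr rfl fun i _ => by
      linear_combination (p.1.2.1 * p.2.1 * sgn i * p.1.2.2 i * p.2.2.2 i) * sgn_mul_self i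
  simp only [pairEquiv_symm_apply, Dlt, Nrm, TrF, sharp_eq, hyp_apply, sum_sgn_mul_mul,
    Qf_sgn_mul, h]
  rw [Qf_eq_lor, lor_comm p.2.2.2 p.1.2.2]; ring

lemma eq_zero_of_symp_eq_zero {x : F n} (h : ∀ y, symp x y = 0) : x = 0 := by
  obtain ⟨α, β, ⟨a, u⟩, ⟨b, w⟩⟩ := x
  have h0 := h (-β, α, -(b, w), (a, u))
  have hu : 0 ≤ u ⬝ᵥ u := Finset.sum_nonneg fun i _ => mul_self_nonneg _
  have hw : 0 ≤ w ⬝ᵥ w := Finset.sum_nonneg fun i _ => mul_self_nonneg _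
  have key : α ^ 2 + β ^ 2 + a ^ 2 + b ^ 2 + 2 * (u ⬝ᵥ u) + 2 * (w ⬝ᵥ w) = 0 := by
    simp only [symp, TrF, Prod.neg_mk, Pi.neg_apply, mul_neg, Finset.sum_neg_distrib] at h0
    simp only [dotProduct]
    linear_combination h0
  have h1 : α = 0 := by nlinarith [sq_nonneg α, sq_nonneg β, sq_nonneg a, sq_nonneg b]
  have h2 : β = 0 := by nlinarith [sq_nonneg α, sq_nonneg β, sq_nonneg a, sq_nonneg b]
  have h3 : a = 0 := by nlinarith [sq_nonneg α, sq_nonneg β, sq_nonneg a, sq_nonneg b]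
  have h4 : b = 0 := by nlinarith [sq_nonneg α, sq_nonneg β, sq_nonneg a, sq_nonneg b]
  have h5 : u = 0 := dotProduct_self_eq_zero.mp
    (by nlinarith [sq_nonneg α, sq_nonneg β, sq_nonneg a, sq_nonneg b])
  have h6 : w = 0 := dotProduct_self_eq_zero.mp
    (by nlinarith [sq_nonneg α, sq_nonneg β, sq_nonneg a, sq_nonneg b])
  subst h1 h2 h3 h4 h5 h6; rfl

lemma isAut_of_linearMap (f : F n →ₗ[ℝ] F n) (hs : ∀ x y, symp (f x) (f y) = symp x y)
    (hd : ∀ x, Dlt (f x) = Dlt x) : IsAut f := by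
  have hinj : Function.Injective f := by
    rw [← LinearMap.ker_eq_bot, LinearMap.ker_eq_bot']
    intro x hx
    refine eq_zero_of_symp_eq_zero fun y => ?_
    rw [← hs, hx]
    simp [symp, TrF]
  exact ⟨⟨hinj, LinearMap.injective_iff_surjective.mp hinj⟩, f.isLinear, hs, hd⟩

lemma autRel_trans {x y z : F n} (hxy : AutRel x y) (hyz : AutRel y z) : AutRel x z := by
  obtain ⟨σ, ⟨hb, hl, hs, hd⟩, rfl⟩ := hxy
  obtain ⟨τ, ⟨hb', hl', hs', hd'⟩, rfl⟩ := hyz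
  exact ⟨τ ∘ σ, ⟨hb'.comp hb, ((hl'.mk' τ).comp (hl.mk' σ)).isLinear,
    fun x y => by simp only [Function.comp_apply, hs', hs],
    fun x => by simp only [Function.comp_apply, hd', hd]⟩, rfl⟩

/-- `Aut`-relatedness transported to pairs of vectors. -/
def PairRel (p p' : Vec n × Vec n) : Prop :=
  AutRel ((pairEquiv n).symm p) ((pairEquiv n).symm p')

lemma PairRel.trans {p q r : Vec n × Vec n} (h : PairRel p q) (h' : PairRel q r) : PairRel p r :=
  autRel_trans h h'

lemma pairRel_of_linearMap (f : Vec n × Vec n →ₗ[ℝ] Vec n × Vec n)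
    (hs : ∀ p q, hyp n (f p).1 (f q).2 - hyp n (f p).2 (f q).1 = hyp n p.1 q.2 - hyp n p.2 q.1)
    (hd : ∀ p, hyp n (f p).1 (f p).1 * hyp n (f p).2 (f p).2 - hyp n (f p).1 (f p).2 ^ 2 =
      hyp n p.1 p.1 * hyp n p.2 p.2 - hyp n p.1 p.2 ^ 2) (p : Vec n × Vec n) :
    PairRel p (f p) := by
  refine ⟨(pairEquiv n).symm.toLinearMap ∘ₗ f ∘ₗ (pairEquiv n).toLinearMap,
    isAut_of_linearMap _ (fun x y => ?_) (fun x => ?_), by simp⟩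
  · obtain ⟨p, rfl⟩ := (pairEquiv n).symm.surjective x
    obtain ⟨q, rfl⟩ := (pairEquiv n).symm.surjective y
    simp [symp_pairEquiv_symm, hs]
  · obtain ⟨p, rfl⟩ := (pairEquiv n).symm.surjective x
    simp [Dlt_pairEquiv_symm, hd]

lemma pairRel_isometry (g : Vec n →ₗ[ℝ] Vec n) (hg : ∀ P Q, hyp n (g P) (g Q) = hyp n P Q)
    (P Q : Vec n) : PairRel (P, Q) (g P, g Q) :=
  pairRel_of_linearMap (g.prodMap g) (fun _ _ => by simp [hg]) (fun _ => by simp [hg]) (P, Q)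

lemma pairRel_special {p q r s : ℝ} (h : p * s - q * r = 1) (P Q : Vec n) :
    PairRel (P, Q) (p • P + q • Q, r • P + s • Q) := by
  let f : Vec n × Vec n →ₗ[ℝ] Vec n × Vec n :=
    LinearMap.prod (p • LinearMap.fst ℝ _ _ + q • LinearMap.snd ℝ _ _)
      (r • LinearMap.fst ℝ _ _ + s • LinearMap.snd ℝ _ _)
  have hf : ∀ z, f z = (p • z.1 + q • z.2, r • z.1 + s • z.2) := fun _ => rfl
  refine pairRel_of_linearMap f (fun x y => ?_) (fun x => ?_) (P, Q)
  · simp only [hf, map_add, map_smul, LinearMap.add_apply, LinearMap.smul_apply, smul_eq_mul]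
    linear_combination (hyp n x.1 y.2 - hyp n x.2 y.1) * h
  · simp only [hf, map_add, map_smul, LinearMap.add_apply, LinearMap.smul_apply, smul_eq_mul,
      hyp_comm x.2 x.1]
    linear_combination (p * s - q * r + 1) *
      (hyp n x.1 x.1 * hyp n x.2 x.2 - hyp n x.1 x.2 ^ 2) * h

/-- Exchanging the two isotropic axes of the hyperbolic plane. -/
def swapAxes (n : ℕ) : Vec n →ₗ[ℝ] Vec n where
  toFun P := (P.2.1, P.1, P.2.2)
  map_add' _ _ := rfl
  map_smul' _ _ := rfl

lemma hyp_swapAxes (P Q : Vec n) : hyp n (swapAxes n P) (swapAxes n Q) = hyp n P Q := by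
  simp only [swapAxes, LinearMap.coe_mk, AddHom.coe_mk, hyp_apply]; ring

/-- The Siegel transformation attached to a Lorentzian vector. -/
noncomputable def siegel (z : Fin n → ℝ) : Vec n →ₗ[ℝ] Vec n where
  toFun P := (P.1, P.2.1 + 2 * lor n P.2.2 z + P.1 * lor n z z, P.2.2 + P.1 • z)
  map_add' P Q := by
    refine Prod.ext rfl (Prod.ext ?_ ?_)
    · simp; ring
    · simp [add_smul]; abel
  map_smul' c P := by
    refine Prod.ext rfl (Prod.ext ?_ ?_)
    · simp; ring
    · simp [mul_smul]

lemma siegel_apply (z : Fin n → ℝ) (P : Vec n) : siegel z P =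
    (P.1, P.2.1 + 2 * lor n P.2.2 z + P.1 * lor n z z, P.2.2 + P.1 • z) := rfl

lemma hyp_siegel (z : Fin n → ℝ) (P Q : Vec n) :
    hyp n (siegel z P) (siegel z Q) = hyp n P Q := by
  simp only [siegel_apply, hyp_apply, map_add, map_smul, LinearMap.add_apply,
    LinearMap.smul_apply, smul_eq_mul, lor_comm z Q.2.2]
  ring

lemma pairRel_swap (P Q : Vec n) : PairRel (P, Q) (Q, -P) := by
  simpa using pairRel_special (p := 0) (q := 1) (r := -1) (s := 0) (by norm_num) P Q

/-- A nonzero vector in the first slot can be given a nonzero first coordinate. -/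
lemma exists_pairRel_fst_ne_zero_of_left (P Q : Vec n) (hP : P ≠ 0) :
    ∃ P' Q' : Vec n, PairRel (P, Q) (P', Q') ∧ P'.1 ≠ 0 := by
  have of_snd : ∀ P Q : Vec n, P.2.1 ≠ 0 →
      ∃ P' Q' : Vec n, PairRel (P, Q) (P', Q') ∧ P'.1 ≠ 0 := fun P Q h =>
    ⟨_, _, pairRel_isometry (swapAxes n) hyp_swapAxes P Q, h⟩
  by_cases h1 : P.1 = 0
  · by_cases h2 : P.2.1 = 0
    · have h3 : P.2.2 ≠ 0 := fun h3 => hP (Prod.ext h1 (Prod.ext h2 h3))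
      obtain ⟨z, hz⟩ := exists_lor_ne_zero h3
      obtain ⟨P', Q', hr, h⟩ := of_snd (siegel z P) (siegel z Q)
        (by simpa [siegel_apply, h1, h2] using hz)
      exact ⟨P', Q', (pairRel_isometry (siegel z) (hyp_siegel z) P Q).trans hr, h⟩
    · exact of_snd P Q h2
  · exact ⟨P, Q, by simpa using pairRel_isometry LinearMap.id (fun _ _ => rfl) P Q, h1⟩

lemma exists_pairRel_fst_ne_zero (P Q : Vec n) (h : (P, Q) ≠ 0) :
    ∃ P' Q' : Vec n, PairRel (P, Q) (P', Q') ∧ P'.1 ≠ 0 := by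
  by_cases hP : P = 0
  · have hQ : Q ≠ 0 := fun hQ => h (Prod.ext hP hQ)
    obtain ⟨P', Q', hr, h'⟩ := exists_pairRel_fst_ne_zero_of_left Q (-P) hQ
    exact ⟨P', Q', (pairRel_swap P Q).trans hr, h'⟩
  · exact exists_pairRel_fst_ne_zero_of_left P Q hP

lemma exists_pairRel_normalized (P Q : Vec n) (h : P.1 ≠ 0) :
    ∃ P' Q' : Vec n, PairRel (P, Q) (P', Q') ∧ P'.1 = 1 ∧ Q'.1 = 0 ∧ P'.2.2 = 0 := by
  have h1 := pairRel_special (p := P.1⁻¹) (q := 0) (r := -Q.1) (s := P.1)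
    (by field_simp; ring) P Q
  set P₁ := P.1⁻¹ • P + (0 : ℝ) • Q with hP₁
  set Q₁ := -Q.1 • P + P.1 • Q with hQ₁
  have hp : P₁.1 = 1 := by simp [hP₁, h]
  have hq : Q₁.1 = 0 := by simp [hQ₁]; ring
  refine ⟨_, _, h1.trans (pairRel_isometry (siegel (-P₁.2.2)) (hyp_siegel _) P₁ Q₁), ?_, ?_, ?_⟩
  · exact hp
  · exact hq
  · simp [siegel_apply, hp]

end FTS

/-- every nonzero element of `F^{2,n}` is `Aut`-related to a reduced
element `(1, β, A, 0)`. -/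
theorem fts_reduced_form (n : ℕ) (hn : 2 ≤ n) (x : F n) (hx : x ≠ 0) :
    ∃ (β : ℝ) (A : J n), AutRel x (1, β, A, 0) := by
  obtain ⟨⟨P₀, Q₀⟩, rfl⟩ := (FTS.pairEquiv n).symm.surjective x
  have hp : (P₀, Q₀) ≠ 0 := fun h => hx (by rw [h, map_zero])
  obtain ⟨P, Q, h1, hP⟩ := FTS.exists_pairRel_fst_ne_zero P₀ Q₀ hp
  obtain ⟨P', Q', h2, ha, hb, hv⟩ := FTS.exists_pairRel_normalized P Q hP
  refine ⟨Q'.2.1, (P'.2.1, Q'.2.2), ?_⟩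
  have h := h1.trans h2
  unfold FTS.PairRel at h
  have hB : ((0 : ℝ), fun i : Fin n => FTS.sgn i * (0 : Fin n → ℝ) i) = 0 := by
    ext <;> simp
  rwa [FTS.pairEquiv_symm_apply (P', Q'), ha, hb, hv, hB] at h
end

section
/- Every nonzero element of F_{2ℝ} is Aut-related to a reduced element of the form (1, β, A, 0) for some β ∈ ℝ and A ∈ J. -/
open Real

/-- The Jordan algebra `J = ℝ ⊕ ℝ`, with elements `A = (a; a₀)`. -/
abbrev J2 : Type := ℝ × ℝ

/-- The cubic norm `N(a; a₀) = a a₀²`. -/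
noncomputable def Nrm2 (A : J2) : ℝ := A.1 * A.2 ^ 2

/-- The quadratic adjoint `(a; a₀)♯ = (a₀²; a a₀)`. -/
noncomputable def sharp2 (A : J2) : J2 := (A.2 ^ 2, A.1 * A.2)

/-- The trace bilinear form `Tr(A,B) = ab + 2 a₀b₀`. -/
noncomputable def TrF2 (A B : J2) : ℝ := A.1 * B.1 + 2 * A.2 * B.2

/-- The Freudenthal triple system `F_{2ℝ} = ℝ ⊕ ℝ ⊕ J ⊕ J`, elements `(α, β, A, B)`. -/
abbrev F2R : Type := ℝ × ℝ × J2 × J2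

/-- The antisymmetric bilinear form `{x, y} = αδ - βγ + Tr(A,D) - Tr(B,C)`. -/
noncomputable def symp2 (x y : F2R) : ℝ :=
  x.1 * y.2.1 - x.2.1 * y.1 + TrF2 x.2.2.1 y.2.2.2 - TrF2 x.2.2.2 y.2.2.1

/-- The quartic form `Δ(x) = -(αβ - Tr(A,B))² - 4(α N(A) + β N(B) - Tr(A♯, B♯))`. -/
noncomputable def Dlt2 (x : F2R) : ℝ :=
  -(x.1 * x.2.1 - TrF2 x.2.2.1 x.2.2.2) ^ 2
    - 4 * (x.1 * Nrm2 x.2.2.1 + x.2.1 * Nrm2 x.2.2.2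
        - TrF2 (sharp2 x.2.2.1) (sharp2 x.2.2.2))

/-- Membership in `Aut(F_{2ℝ})`: an invertible `ℝ`-linear map preserving `{,}` and `Δ`. -/
def IsAut2 (σ : F2R → F2R) : Prop :=
  Function.Bijective σ ∧ IsLinearMap ℝ σ ∧
    (∀ x y, symp2 (σ x) (σ y) = symp2 x y) ∧ ∀ x, Dlt2 (σ x) = Dlt2 x

/-- `Aut`-relatedness of two elements of `F_{2ℝ}`. -/
def AutRel2 (x y : F2R) : Prop := ∃ σ, IsAut2 σ ∧ σ x = y

/-- `T` is the triple-product map: `{T(x), z} = ½ (d/ds)|₀ Δ(x + s z)` for all `x, z`. -/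
def IsTripleMap2 (T : F2R → F2R) : Prop :=
  ∀ x z, symp2 (T x) z = (1 / 2) * deriv (fun s : ℝ => Dlt2 (x + s • z)) 0

/-- `Υ(x, y) = (d/ds)|₀ T(x + s y) + {x, y} x`. -/
noncomputable def Ups2 (T : F2R → F2R) (x y : F2R) : F2R :=
  deriv (fun s : ℝ => T (x + s • y)) 0 + symp2 x y • x

/-- The bilinear form `{·,·}` is nondegenerate. -/
theorem eq_zero_of_symp2_eq_zero {x : F2R} (h : ∀ y, symp2 x y = 0) : x = 0 := by
  obtain ⟨α, β, ⟨a, a₀⟩, ⟨b, b₀⟩⟩ := x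
  have hα := h (0, 1, (0, 0), (0, 0))
  have hβ := h (1, 0, (0, 0), (0, 0))
  have ha := h (0, 0, (0, 0), (1, 0))
  have ha₀ := h (0, 0, (0, 0), (0, 1))
  have hb := h (0, 0, (1, 0), (0, 0))
  have hb₀ := h (0, 0, (0, 1), (0, 0))
  simp [symp2, TrF2] at hα hβ ha ha₀ hb hb₀
  simp [*]

/-- Bijectivity is automatic for a linear map preserving the nondegenerate form `{·,·}`. -/
theorem IsLinearMap.isAut2 {σ : F2R → F2R} (hl : IsLinearMap ℝ σ)
    (hs : ∀ x y, symp2 (σ x) (σ y) = symp2 x y) (hd : ∀ x, Dlt2 (σ x) = Dlt2 x) :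
    IsAut2 σ := by
  have hinj : Function.Injective (hl.mk' σ) := by
    refine (injective_iff_map_eq_zero (hl.mk' σ)).2 fun x hx => eq_zero_of_symp2_eq_zero fun y => ?_
    have hx' : σ x = 0 := hx
    rw [← hs, hx']
    simp [symp2, TrF2]
  exact ⟨⟨hinj, LinearMap.injective_iff_surjective.1 hinj⟩, hl, hs, hd⟩

theorem AutRel2.trans {x y z : F2R} (hxy : AutRel2 x y) (hyz : AutRel2 y z) : AutRel2 x z := by
  obtain ⟨σ, ⟨hσb, hσl, hσs, hσd⟩, rfl⟩ := hxy
  obtain ⟨τ, ⟨hτb, hτl, hτs, hτd⟩, rfl⟩ := hyz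
  refine ⟨τ ∘ σ, ⟨hτb.comp hσb, ((hτl.mk' τ).comp (hσl.mk' σ)).isLinear, ?_, ?_⟩, rfl⟩
  · intro x y
    simp only [Function.comp_apply, hτs, hσs]
  · intro x
    simp only [Function.comp_apply, hτd, hσd]

/-! We view `(α, β, (a, a₀), (b, b₀))` as the pair of binary quadratic forms
`Q₀ = α s² + 2 b₀ s t + a t²` and `Q₁ = b s² + 2 a₀ s t + β t²`, on which `SL₂ × SL₂` acts by
recombining the two forms and by substitution in `(s, t)`. -/

/-- Replace `Q₁` by `Q₁ + c Q₀`. -/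
theorem autRel2_add_form (c α β a a₀ b b₀ : ℝ) :
    AutRel2 (α, β, (a, a₀), (b, b₀)) (α, β + c * a, (a, a₀ + c * b₀), (b + c * α, b₀)) := by
  refine ⟨fun x => (x.1, x.2.1 + c * x.2.2.1.1, (x.2.2.1.1, x.2.2.1.2 + c * x.2.2.2.2),
    (x.2.2.2.1 + c * x.1, x.2.2.2.2)), IsLinearMap.isAut2 ⟨?_, ?_⟩ ?_ ?_, rfl⟩
  · intro x y
    ext <;> simp <;> ring
  · intro r x
    ext <;> simp <;> ring
  · intro x y
    simp only [symp2, TrF2]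
    ring
  · intro x
    simp only [Dlt2, TrF2, Nrm2, sharp2]
    ring

/-- Substitute `s + c t` for `s`. -/
theorem autRel2_shear_var (c α β a a₀ b b₀ : ℝ) :
    AutRel2 (α, β, (a, a₀), (b, b₀))
      (α, β + 2 * c * a₀ + c ^ 2 * b, (a + 2 * c * b₀ + c ^ 2 * α, a₀ + c * b),
        (b, b₀ + c * α)) := by
  refine ⟨fun x => (x.1, x.2.1 + 2 * c * x.2.2.1.2 + c ^ 2 * x.2.2.2.1,
    (x.2.2.1.1 + 2 * c * x.2.2.2.2 + c ^ 2 * x.1, x.2.2.1.2 + c * x.2.2.2.1),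
    (x.2.2.2.1, x.2.2.2.2 + c * x.1)), IsLinearMap.isAut2 ⟨?_, ?_⟩ ?_ ?_, rfl⟩
  · intro x y
    ext <;> simp <;> ring
  · intro r x
    ext <;> simp <;> ring
  · intro x y
    simp only [symp2, TrF2]
    ring
  · intro x
    simp only [Dlt2, TrF2, Nrm2, sharp2]
    ring

/-- Replace `(Q₀, Q₁)` by `(-Q₁, Q₀)`. -/
theorem autRel2_swap_form (α β a a₀ b b₀ : ℝ) :
    AutRel2 (α, β, (a, a₀), (b, b₀)) (-b, a, (-β, b₀), (α, -a₀)) := by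
  refine ⟨fun x => (-x.2.2.2.1, x.2.2.1.1, (-x.2.1, x.2.2.2.2), (x.1, -x.2.2.1.2)),
    IsLinearMap.isAut2 ⟨?_, ?_⟩ ?_ ?_, rfl⟩
  · intro x y
    ext <;> simp <;> ring
  · intro r x
    ext <;> simp
  · intro x y
    simp only [symp2, TrF2]
    ring
  · intro x
    simp only [Dlt2, TrF2, Nrm2, sharp2]
    ring

/-- Substitute `(t, -s)` for `(s, t)`. -/
theorem autRel2_swap_var (α β a a₀ b b₀ : ℝ) :
    AutRel2 (α, β, (a, a₀), (b, b₀)) (a, b, (α, -a₀), (β, -b₀)) := by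
  refine ⟨fun x => (x.2.2.1.1, x.2.2.2.1, (x.1, -x.2.2.1.2), (x.2.1, -x.2.2.2.2)),
    IsLinearMap.isAut2 ⟨?_, ?_⟩ ?_ ?_, rfl⟩
  · intro x y
    ext <;> simp <;> ring
  · intro r x
    ext <;> simp
  · intro x y
    simp only [symp2, TrF2]
    ring
  · intro x
    simp only [Dlt2, TrF2, Nrm2, sharp2]
    ring

/-- Replace `(Q₀, Q₁)` by `(c Q₀, c⁻¹ Q₁)`. -/
theorem autRel2_scale {c : ℝ} (hc : c ≠ 0) (α β a a₀ b b₀ : ℝ) :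
    AutRel2 (α, β, (a, a₀), (b, b₀))
      (c * α, c⁻¹ * β, (c * a, c⁻¹ * a₀), (c⁻¹ * b, c * b₀)) := by
  refine ⟨fun x => (c * x.1, c⁻¹ * x.2.1, (c * x.2.2.1.1, c⁻¹ * x.2.2.1.2),
    (c⁻¹ * x.2.2.2.1, c * x.2.2.2.2)), IsLinearMap.isAut2 ⟨?_, ?_⟩ ?_ ?_, rfl⟩
  · intro x y
    ext <;> simp <;> ring
  · intro r x
    ext <;> simp <;> ring
  · intro x y
    simp only [symp2, TrF2]
    field_simp
  · intro x
    simp only [Dlt2, TrF2, Nrm2, sharp2]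
    field_simp

theorem exists_autRel2_reduced_of_fst_ne_zero {α : ℝ} (hα : α ≠ 0) (β a a₀ b b₀ : ℝ) :
    ∃ (β' : ℝ) (A : J2), AutRel2 (α, β, (a, a₀), (b, b₀)) (1, β', A, 0) := by
  have h := ((autRel2_add_form (-b / α) α β a a₀ b b₀).trans
    (autRel2_shear_var (-b₀ / α) _ _ _ _ _ _)).trans
    (autRel2_scale (inv_ne_zero hα) _ _ _ _ _ _)
  have hb : b + -b / α * α = 0 := by field_simp; ring
  have hb₀ : b₀ + -b₀ / α * α = 0 := by field_simp; ring
  simp only [inv_mul_cancel₀ hα, hb, hb₀, mul_zero] at h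
  exact ⟨_, _, h⟩

/-- every nonzero element of `F_{2ℝ}` is `Aut`-related to a reduced element
`(1, β, A, 0)`. -/
theorem f2r_reduced_form (x : F2R) (hx : x ≠ 0) :
    ∃ (β : ℝ) (A : J2), AutRel2 x (1, β, A, 0) := by
  obtain ⟨α, β, ⟨a, a₀⟩, ⟨b, b₀⟩⟩ := x
  have step {y z : F2R} (h : AutRel2 y z) (hz : ∃ (β : ℝ) (A : J2), AutRel2 z (1, β, A, 0)) :
      ∃ (β : ℝ) (A : J2), AutRel2 y (1, β, A, 0) := by
    obtain ⟨β, A, hA⟩ := hz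
    exact ⟨β, A, h.trans hA⟩
  have of_a {α β a a₀ b b₀ : ℝ} (ha : a ≠ 0) :=
    step (autRel2_swap_var α β a a₀ b b₀) (exists_autRel2_reduced_of_fst_ne_zero ha _ _ _ _ _)
  have of_β {α β a a₀ b b₀ : ℝ} (hβ : β ≠ 0) :=
    step (autRel2_swap_form α β a a₀ b b₀) (of_a (neg_ne_zero.2 hβ))
  by_cases hα : α = 0
  swap
  · exact exists_autRel2_reduced_of_fst_ne_zero hα _ _ _ _ _
  by_cases hb : b = 0
  swap
  · exact step (autRel2_swap_form _ _ _ _ _ _)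
      (exists_autRel2_reduced_of_fst_ne_zero (neg_ne_zero.2 hb) _ _ _ _ _)
  by_cases ha : a = 0
  swap
  · exact of_a ha
  by_cases hβ : β = 0
  swap
  · exact of_β hβ
  subst hα hb ha hβ
  by_cases hb₀ : b₀ = 0
  · have ha₀ : a₀ ≠ 0 := by
      rintro rfl
      exact hx (by simp [hb₀])
    exact step (autRel2_shear_var 1 _ _ _ _ _ _) (of_β (by simpa using ha₀))
  · exact step (autRel2_shear_var 1 _ _ _ _ _ _) (of_a (by simpa using hb₀))
end

section
/- Every nonzero element of F_ℝ is SL(2,ℝ)-related to a reduced element of the form (1, β, A, 0) for some β, A ∈ ℝ; equivalently, every nonzero real binary cubic form is taken, by an SL(2,ℝ) linear substitution of variables, to one of the form u³ + 3A·uv² + β·v³. -/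
open Real

/-- A nonzero real binary cubic form takes a positive value. -/
theorem exists_cub_pos (x : FR) (hx : x ≠ 0) : ∃ a b : ℝ, 0 < cub x a b := by
  by_contra! h
  have neg_eq (a b : ℝ) : cub x (-a) (-b) = -cub x a b := by simp only [cub]; ring
  have eq_zero (a b : ℝ) : cub x a b = 0 := by
    linarith [h a b, h (-a) (-b), neg_eq a b]
  obtain ⟨α, β, A, B⟩ := x
  have h10 := eq_zero 1 0
  have h01 := eq_zero 0 1
  have h11 := eq_zero 1 1
  have h1m := eq_zero 1 (-1)
  simp only [cub] at h10 h01 h11 h1m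
  refine hx (Prod.ext ?_ (Prod.ext ?_ (Prod.ext ?_ ?_))) <;>
    simp only [Prod.fst_zero, Prod.snd_zero] <;> linarith

/-- A nonzero real binary cubic form represents `1`. -/
theorem exists_cub_eq_one (x : FR) (hx : x ≠ 0) : ∃ a b : ℝ, cub x a b = 1 := by
  obtain ⟨a, b, hab⟩ := exists_cub_pos x hx
  obtain ⟨r, hr⟩ : ∃ r : ℝ, r ^ 3 = (cub x a b)⁻¹ :=
    ⟨_, Real.rpow_inv_natCast_pow (inv_pos.2 hab).le three_ne_zero⟩
  refine ⟨r * a, r * b, ?_⟩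
  calc cub x (r * a) (r * b) = r ^ 3 * cub x a b := by simp only [cub]; ring
    _ = 1 := by rw [hr, inv_mul_cancel₀ hab.ne']

/-- The polarization of `cub x`, quadratic in `(a, b)` and linear in `(c, d)`. -/
noncomputable def cubPolar (x : FR) (a b c d : ℝ) : ℝ :=
  x.1 * a ^ 2 * c + x.2.2.2 * (a ^ 2 * d + 2 * a * b * c)
    + x.2.2.1 * (2 * a * b * d + b ^ 2 * c) + x.2.1 * b ^ 2 * d

theorem cub_linear_substitution (x : FR) (a b c d u v : ℝ) :
    cub x (a * u + c * v) (b * u + d * v) =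
      cub (cub x a b, cub x c d, cubPolar x c d a b, cubPolar x a b c d) u v := by
  simp only [cub, cubPolar]
  ring

/-- A vector `(a, b)` on which a binary cubic form is `1` is the first row of a matrix in
`SL(2,ℝ)` whose second row is polar to it. -/
theorem exists_det_eq_one_cubPolar_eq_zero (x : FR) (a b : ℝ) (hab : cub x a b = 1) :
    ∃ c d : ℝ, a * d - b * c = 1 ∧ cubPolar x a b c d = 0 := by
  have hn : a ^ 2 + b ^ 2 ≠ 0 := by
    intro h
    have ha : a = 0 := by nlinarith
    have hb : b = 0 := by nlinarith
    simp [cub, ha, hb] at hab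
  obtain ⟨c, d, hdet⟩ : ∃ c d : ℝ, a * d - b * c = 1 :=
    ⟨-b / (a ^ 2 + b ^ 2), a / (a ^ 2 + b ^ 2), by field_simp; ring⟩
  refine ⟨c - cubPolar x a b c d * a, d - cubPolar x a b c d * b,
    by linear_combination hdet, ?_⟩
  calc cubPolar x a b (c - cubPolar x a b c d * a) (d - cubPolar x a b c d * b)
      = cubPolar x a b c d * (1 - cub x a b) := by simp only [cub, cubPolar]; ring
    _ = 0 := by rw [hab, sub_self, mul_zero]

/-- every nonzero element of `F_ℝ` is `SL(2,ℝ)`-related to a reduced element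
`(1, β, A, 0)`, i.e. every nonzero real binary cubic form is taken by an `SL(2,ℝ)`
substitution to one of the form `u³ + 3A uv² + β v³`. -/
theorem fr_reduced_form (x : FR) (hx : x ≠ 0) :
    ∃ β A : ℝ, SLRel x (1, β, A, 0) := by
  obtain ⟨a, b, hab⟩ := exists_cub_eq_one x hx
  obtain ⟨c, d, hdet, hpolar⟩ := exists_det_eq_one_cubPolar_eq_zero x a b hab
  refine ⟨cub x c d, cubPolar x c d a b, a, b, c, d, hdet, fun u v => ?_⟩
  rw [cub_linear_substitution, hab, hpolar]
end

section
/- Let n ≥ 2, let E₁ = (1; 0, …, 0), E₂ = (0; ½, ½, 0, …, 0), E₃ = (0; ½, −½, 0, …, 0) in J, and let α, β, a₁, a₂, a₃, c ∈ ℝ with α ≠ 0. Then the element (α, β, a₁E₁ + a₂E₂ + a₃E₃, 0) of F^{2,n} is Aut-related to each of the three elements: (α, β − 2a₂a₃c/α, (a₁ + βc − a₂a₃c²/α)E₁ + a₂E₂ + a₃E₃, 0); (α, β − 2a₁a₃c/α, a₁E₁ + (a₂ + βc − a₁a₃c²/α)E₂ + a₃E₃, 0); and (α, β − 2a₁a₂c/α,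 a₁E₁ + a₂E₂ + (a₃ + βc − a₁a₂c²/α)E₃, 0). -/
open Real Matrix

/-- Raising an index with the Lorentzian metric: `(v₀, v₁, …) ↦ (v₀, -v₁, …)`. -/
noncomputable def lorentzFlip {n : ℕ} (v : Fin n → ℝ) : Fin n → ℝ :=
  fun i => (if (i : ℕ) = 0 then (1 : ℝ) else -1) * v i

section lorentzFlip

variable {n : ℕ}

lemma lorentzFlip_add (u v : Fin n → ℝ) :
    lorentzFlip (u + v) = lorentzFlip u + lorentzFlip v := by
  funext i; simp [lorentzFlip, mul_add]

lemma lorentzFlip_smul (c : ℝ) (v : Fin n → ℝ) :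
    lorentzFlip (c • v) = c • lorentzFlip v := by
  funext i; simp [lorentzFlip]

lemma lorentzFlip_neg (v : Fin n → ℝ) : lorentzFlip (-v) = -lorentzFlip v := by
  funext i; simp [lorentzFlip]

lemma lorentzFlip_lorentzFlip (v : Fin n → ℝ) : lorentzFlip (lorentzFlip v) = v := by
  funext i; simp only [lorentzFlip]; split_ifs <;> ring

lemma lorentzFlip_dotProduct (u v : Fin n → ℝ) :
    lorentzFlip u ⬝ᵥ v = u ⬝ᵥ lorentzFlip v := by
  simp only [dotProduct, lorentzFlip]
  exact Finset.sum_congr rfl fun i _ => by ring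

lemma Qf_eq_dotProduct (v : Fin n → ℝ) : Qf v = v ⬝ᵥ lorentzFlip v := by
  simp only [dotProduct, lorentzFlip, Qf]
  exact Finset.sum_congr rfl fun i _ => by ring

lemma TrF_eq_dotProduct (A B : J n) : TrF A B = A.1 * B.1 + 2 * (A.2 ⬝ᵥ B.2) := rfl

lemma sharp_eq_lorentzFlip (A : J n) :
    sharp A = (A.2 ⬝ᵥ lorentzFlip A.2, A.1 • lorentzFlip A.2) := by
  refine Prod.ext (Qf_eq_dotProduct _) (funext fun i => ?_)
  simp only [sharp, lorentzFlip, Pi.smul_apply, smul_eq_mul]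
  split_ifs <;> ring

end lorentzFlip

section vec2

variable {n : ℕ}

lemma vec2_add (x y z w : ℝ) :
    (vec2 x y + vec2 z w : Fin n → ℝ) = vec2 (x + z) (y + w) := by
  funext i; simp only [vec2, Pi.add_apply]; split_ifs <;> simp

lemma smul_vec2 (c x y : ℝ) : (c • vec2 x y : Fin n → ℝ) = vec2 (c * x) (c * y) := by
  funext i; simp only [vec2, Pi.smul_apply, smul_eq_mul]; split_ifs <;> simp

lemma zero_eq_vec2 : (0 : Fin n → ℝ) = vec2 0 0 := by
  funext i; simp [vec2]

lemma lorentzFlip_vec2 (x y : ℝ) : lorentzFlip (vec2 x y : Fin n → ℝ) = vec2 x (-y) := by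
  funext i; simp only [lorentzFlip, vec2]; split_ifs <;> simp

lemma vec2_dotProduct_vec2 (hn : 2 ≤ n) (x y z w : ℝ) :
    (vec2 x y : Fin n → ℝ) ⬝ᵥ vec2 z w = x * z + y * w := by
  obtain ⟨m, rfl⟩ := Nat.exists_eq_add_of_le' hn
  simp [dotProduct, Fin.sum_univ_succ, vec2]

end vec2

lemma IsAut.comp {n : ℕ} {σ τ : F n → F n} (hσ : IsAut σ) (hτ : IsAut τ) : IsAut (σ ∘ τ) :=
  ⟨hσ.1.comp hτ.1, (hσ.2.1.mk' σ ∘ₗ hτ.2.1.mk' τ).isLinear,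
    fun x y => (hσ.2.2.1 _ _).trans (hτ.2.2.1 x y),
    fun x => (hσ.2.2.2 _).trans (hτ.2.2.2 x)⟩

/-- The involution `(α, β, A, B) ↦ (β, α, B, A)`, which preserves `Δ` and negates `{,}`. -/
def ftsSwap {n : ℕ} (x : F n) : F n := (x.2.1, x.1, x.2.2.2, x.2.2.1)

/-- The shear `φ(C)` of the Freudenthal triple system for `C = (c; 0)`. -/
noncomputable def scalarShear {n : ℕ} (c : ℝ) (x : F n) : F n :=
  (x.1 + c * x.2.2.2.1, x.2.1, (x.2.2.1.1 + c * x.2.1, x.2.2.1.2),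
    (x.2.2.2.1, x.2.2.2.2 + c • lorentzFlip x.2.2.1.2))

/-- The shear `φ(C)` of the Freudenthal triple system for `C = (0; w)`. -/
noncomputable def vectorShear {n : ℕ} (w : Fin n → ℝ) (x : F n) : F n :=
  (x.1 + 2 * (x.2.2.2.2 ⬝ᵥ w) + x.2.2.1.1 * (w ⬝ᵥ lorentzFlip w), x.2.1,
    (x.2.2.1.1, x.2.2.1.2 + x.2.1 • w),
    (x.2.2.2.1 + 2 * (x.2.2.1.2 ⬝ᵥ lorentzFlip w) + x.2.1 * (w ⬝ᵥ lorentzFlip w),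
      x.2.2.2.2 + x.2.2.1.1 • lorentzFlip w))

section shears

variable {n : ℕ}

lemma IsAut.ftsSwap_conj {σ : F n → F n} (hσ : IsAut σ) :
    IsAut (fun x => ftsSwap (σ (ftsSwap x))) := by
  have hs : Function.Involutive (ftsSwap (n := n)) := fun _ => rfl
  have hsymp : ∀ x y : F n, symp (ftsSwap x) (ftsSwap y) = -symp x y := fun x y => by
    simp only [symp, ftsSwap]; ring
  have hΔ : ∀ x : F n, Dlt (ftsSwap x) = Dlt x := fun x => by
    simp only [Dlt, ftsSwap, TrF_eq_dotProduct, dotProduct_comm x.2.2.2.2,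
      dotProduct_comm (sharp x.2.2.2).2]
    ring
  refine ⟨hs.bijective.comp (hσ.1.comp hs.bijective), ⟨fun x y => ?_, fun c x => ?_⟩,
    fun x y => ?_, fun x => ?_⟩
  · exact congrArg ftsSwap (hσ.2.1.map_add (ftsSwap x) (ftsSwap y))
  · exact congrArg ftsSwap (hσ.2.1.map_smul c (ftsSwap x))
  · rw [hsymp, hσ.2.2.1, hsymp, neg_neg]
  · rw [hΔ, hσ.2.2.2, hΔ]

lemma scalarShear_neg_scalarShear (c : ℝ) (x : F n) : scalarShear (-c) (scalarShear c x) = x := by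
  simp [scalarShear]

lemma vectorShear_neg_vectorShear (w : Fin n → ℝ) (x : F n) :
    vectorShear (-w) (vectorShear w x) = x := by
  obtain ⟨α, β, ⟨a, u⟩, b, v⟩ := x
  have h : lorentzFlip w ⬝ᵥ w = w ⬝ᵥ lorentzFlip w := lorentzFlip_dotProduct w w
  simp only [vectorShear, lorentzFlip_neg, dotProduct_neg, neg_dotProduct, add_dotProduct,
    smul_dotProduct, smul_neg, add_neg_cancel_right, smul_eq_mul, Prod.mk.injEq, true_and,
    and_true, h]
  constructor <;> ring

lemma isAut_scalarShear (c : ℝ) : IsAut (scalarShear (n := n) c) := by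
  refine ⟨Function.bijective_iff_has_inverse.2 ⟨scalarShear (-c),
    scalarShear_neg_scalarShear c, fun x => ?_⟩, ⟨fun x y => ?_, fun r x => ?_⟩,
    fun x y => ?_, fun x => ?_⟩
  · simpa using scalarShear_neg_scalarShear (-c) x
  · simp only [scalarShear, Prod.fst_add, Prod.snd_add, Prod.mk_add_mk, lorentzFlip_add,
      Prod.mk.injEq, smul_add, true_and, and_true]
    exact ⟨by ring, by ring, by abel⟩
  · simp only [scalarShear, Prod.smul_fst, Prod.smul_snd, Prod.smul_mk, lorentzFlip_smul,
      Prod.mk.injEq, smul_add, smul_eq_mul, true_and, smul_comm c r, and_true]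
    refine ⟨by ring, by ring⟩
  · simp only [symp, scalarShear, TrF_eq_dotProduct, dotProduct_add, add_dotProduct,
      dotProduct_smul, smul_dotProduct, smul_eq_mul, lorentzFlip_dotProduct]
    ring
  · simp only [Dlt, Nrm, Qf_eq_dotProduct, scalarShear, TrF_eq_dotProduct, sharp_eq_lorentzFlip,
      dotProduct_add, add_dotProduct, lorentzFlip_add, lorentzFlip_smul, lorentzFlip_lorentzFlip,
      dotProduct_smul, smul_dotProduct, smul_eq_mul, lorentzFlip_dotProduct,
      dotProduct_comm x.2.2.2.2 x.2.2.1.2]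
    ring

lemma isAut_vectorShear (w : Fin n → ℝ) : IsAut (vectorShear w) := by
  refine ⟨Function.bijective_iff_has_inverse.2 ⟨vectorShear (-w),
    vectorShear_neg_vectorShear w, fun x => ?_⟩, ⟨fun x y => ?_, fun r x => ?_⟩,
    fun x y => ?_, fun x => ?_⟩
  · simpa using vectorShear_neg_vectorShear (-w) x
  · simp only [vectorShear, Prod.fst_add, Prod.snd_add, Prod.mk_add_mk, add_dotProduct,
      Prod.mk.injEq, add_smul, true_and]
    refine ⟨by ring, by abel, by ring, by abel⟩
  · simp only [vectorShear, Prod.smul_fst, Prod.smul_snd, Prod.smul_mk, smul_dotProduct,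
      Prod.mk.injEq, smul_add, smul_eq_mul, true_and, mul_smul, and_true]
    refine ⟨by ring, by ring⟩
  · simp only [symp, vectorShear, TrF_eq_dotProduct, dotProduct_add, add_dotProduct,
      dotProduct_smul, smul_dotProduct, smul_eq_mul, lorentzFlip_dotProduct,
      dotProduct_comm w y.2.2.2.2, dotProduct_comm w (lorentzFlip y.2.2.1.2)]
    ring
  · have h := dotProduct_comm (lorentzFlip w) x.2.2.1.2
    rw [lorentzFlip_dotProduct] at h
    simp only [Dlt, Nrm, Qf_eq_dotProduct, vectorShear, TrF_eq_dotProduct, sharp_eq_lorentzFlip,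
      dotProduct_add, add_dotProduct, lorentzFlip_add, lorentzFlip_smul, lorentzFlip_lorentzFlip,
      dotProduct_smul, smul_dotProduct, smul_eq_mul, lorentzFlip_dotProduct, h,
      dotProduct_comm w x.2.2.2.2]
    ring

end shears

lemma AutRel.scalar_shift {n : ℕ} (hn : 2 ≤ n) {α : ℝ} (hα : α ≠ 0) (β a x y c : ℝ) :
    AutRel ((α, β, (a, vec2 x y), 0) : F n)
      (α, β - 2 * (x ^ 2 - y ^ 2) * c / α,
        (a + β * c - (x ^ 2 - y ^ 2) * c ^ 2 / α, vec2 x y), 0) := by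
  refine ⟨_, (isAut_vectorShear (vec2 (-(c / α * x)) (c / α * y))).ftsSwap_conj.comp
    (isAut_scalarShear c), ?_⟩
  simp only [Function.comp_apply, ftsSwap, scalarShear, vectorShear, Prod.fst_zero, Prod.snd_zero,
    zero_eq_vec2 (n := n), lorentzFlip_vec2, smul_vec2, vec2_add, vec2_dotProduct_vec2 hn,
    Prod.mk.injEq, Prod.mk_eq_zero]
  refine ⟨?_, ?_, ⟨?_, congrArg₂ vec2 ?_ ?_⟩, trivial, congrArg₂ vec2 ?_ ?_⟩ <;>
    field_simp <;> ring

lemma AutRel.null_shift {n : ℕ} (hn : 2 ≤ n) {α : ℝ} (hα : α ≠ 0) (β a x y c ε : ℝ)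
    (hε : ε = 1 ∨ ε = -1) :
    AutRel ((α, β, (a, vec2 x y), 0) : F n)
      (α, β - 2 * a * (x - ε * y) * c / α,
        (a, vec2 (x + (β * c - a * (x - ε * y) * c ^ 2 / α) / 2)
          (y + ε * (β * c - a * (x - ε * y) * c ^ 2 / α) / 2)), 0) := by
  refine ⟨_, ((isAut_vectorShear
    (vec2 (-(a * c / (2 * α))) (a * c / (2 * α) * ε))).ftsSwap_conj.comp
    (isAut_scalarShear (-(c * (x - ε * y) / α))).ftsSwap_conj).comp
    (isAut_vectorShear (vec2 (c / 2) (c / 2 * ε))), ?_⟩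
  simp only [Function.comp_apply, ftsSwap, scalarShear, vectorShear, Prod.fst_zero, Prod.snd_zero,
    zero_eq_vec2 (n := n), lorentzFlip_vec2, smul_vec2, vec2_add, vec2_dotProduct_vec2 hn,
    Prod.mk.injEq, Prod.mk_eq_zero]
  refine ⟨?_, ?_, ⟨?_, congrArg₂ vec2 ?_ ?_⟩, ?_, congrArg₂ vec2 ?_ ?_⟩ <;>
    rcases hε with rfl | rfl <;> field_simp <;> ring

/-- for `α ≠ 0`, the element `(α, β, a₁E₁ + a₂E₂ + a₃E₃, 0)` of `F^{2,n}` is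
`Aut`-related to each of the three elements obtained by shifting one idempotent
coefficient by `βc - (product of the other two)c²/α` and adjusting `β` accordingly. -/
theorem fts_idempotent_shift (n : ℕ) (hn : 2 ≤ n) (α β a1 a2 a3 c : ℝ) (hα : α ≠ 0) :
    let E1 : J n := ((1 : ℝ), (0 : Fin n → ℝ))
    let E2 : J n := ((0 : ℝ), vec2 (1 / 2) (1 / 2))
    let E3 : J n := ((0 : ℝ), vec2 (1 / 2) (-(1 / 2)))
    AutRel (α, β, a1 • E1 + a2 • E2 + a3 • E3, 0)
        (α, β - 2 * a2 * a3 * c / α,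
          (a1 + β * c - a2 * a3 * c ^ 2 / α) • E1 + a2 • E2 + a3 • E3, 0) ∧
    AutRel (α, β, a1 • E1 + a2 • E2 + a3 • E3, 0)
        (α, β - 2 * a1 * a3 * c / α,
          a1 • E1 + (a2 + β * c - a1 * a3 * c ^ 2 / α) • E2 + a3 • E3, 0) ∧
    AutRel (α, β, a1 • E1 + a2 • E2 + a3 • E3, 0)
        (α, β - 2 * a1 * a2 * c / α,
          a1 • E1 + a2 • E2 + (a3 + β * c - a1 * a2 * c ^ 2 / α) • E3, 0) := by
  intro E1 E2 E3
  have hJ : ∀ r s t : ℝ, r • E1 + s • E2 + t • E3 = (r, vec2 ((s + t) / 2) ((s - t) / 2)) := by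
    intro r s t
    simp only [E1, E2, E3, zero_eq_vec2, Prod.smul_mk, Prod.mk_add_mk, smul_vec2, vec2_add,
      smul_eq_mul]
    congr 2 <;> ring
  simp only [hJ]
  refine ⟨?_, ?_, ?_⟩
  · convert AutRel.scalar_shift hn hα β a1 ((a2 + a3) / 2) ((a2 - a3) / 2) c using 6 <;> ring
  · convert AutRel.null_shift hn hα β a1 ((a2 + a3) / 2) ((a2 - a3) / 2) c 1 (.inl rfl)
      using 6 <;> ring
  · convert AutRel.null_shift hn hα β a1 ((a2 + a3) / 2) ((a2 - a3) / 2) c (-1) (.inr rfl)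
      using 6 <;> ring
end

section
/- Let n ≥ 2. Every rank-1 element of F^{2,n}, i.e. every x ≠ 0 with Υ(x, y) = 0 for all y ∈ F^{2,n}, is Aut-related to the canonical form x₁ = (1, 0, 0, 0). -/
open Real Matrix

/-- The sign of the `i`-th coordinate in the Lorentzian metric. -/
def lorentzSign {n : ℕ} (i : Fin n) : ℝ := if (i : ℕ) = 0 then 1 else -1

lemma lorentzSign_mul_self {n : ℕ} (i : Fin n) : lorentzSign i * lorentzSign i = 1 := by
  unfold lorentzSign; split_ifs <;> norm_num

/-- The Lorentzian vector space plus a hyperbolic plane, of signature `(2, n)`. -/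
abbrev ConfSpace (n : ℕ) : Type := (Fin n → ℝ) × ℝ × ℝ

/-- The symmetric bilinear form of signature `(2, n)` on `ConfSpace n`. -/
noncomputable def confForm (n : ℕ) : ConfSpace n →ₗ[ℝ] ConfSpace n →ₗ[ℝ] ℝ :=
  LinearMap.mk₂ ℝ
    (fun z w => ∑ i, lorentzSign i * (z.1 i * w.1 i) - (z.2.1 * w.2.2 + z.2.2 * w.2.1) / 2)
    (fun z z' w => by
      simp only [Prod.fst_add, Prod.snd_add, Pi.add_apply, add_mul, mul_add,
        Finset.sum_add_distrib]
      ring)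
    (fun c z w => by
      simp only [Prod.smul_fst, Prod.smul_snd, Pi.smul_apply, smul_eq_mul, mul_sub,
        Finset.mul_sum]
      congr 1
      · exact Finset.sum_congr rfl fun i _ => by ring
      · ring)
    (fun z w w' => by
      simp only [Prod.fst_add, Prod.snd_add, Pi.add_apply, mul_add, Finset.sum_add_distrib]
      ring)
    (fun c z w => by
      simp only [Prod.smul_fst, Prod.smul_snd, Pi.smul_apply, smul_eq_mul, mul_sub,
        Finset.mul_sum]
      congr 1
      · exact Finset.sum_congr rfl fun i _ => by ring
      · ring)

lemma confForm_apply {n : ℕ} (z w : ConfSpace n) :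
    confForm n z w =
      ∑ i, lorentzSign i * (z.1 i * w.1 i) - (z.2.1 * w.2.2 + z.2.2 * w.2.1) / 2 := rfl

lemma confForm_comm {n : ℕ} (z w : ConfSpace n) : confForm n z w = confForm n w z := by
  simp only [confForm_apply, mul_comm]
  ring

lemma eq_zero_of_confForm_eq_zero {n : ℕ} {z : ConfSpace n} (h : ∀ w, confForm n z w = 0) :
    z = 0 := by
  have h1 := h (fun i => lorentzSign i * z.1 i, -2 * z.2.2, -2 * z.2.1)
  have h2 : ∀ i, lorentzSign i * (z.1 i * (lorentzSign i * z.1 i)) = z.1 i ^ 2 := fun i => by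
    linear_combination z.1 i ^ 2 * lorentzSign_mul_self i
  simp only [confForm_apply, h2] at h1
  have h3 : 0 ≤ ∑ i, z.1 i ^ 2 := Finset.sum_nonneg fun i _ => sq_nonneg _
  have h4 : ∑ i, z.1 i ^ 2 = 0 := by nlinarith [sq_nonneg z.2.1, sq_nonneg z.2.2]
  have h5 : z.2.1 = 0 := by nlinarith [sq_nonneg z.2.1, sq_nonneg z.2.2]
  have h6 : z.2.2 = 0 := by nlinarith [sq_nonneg z.2.1, sq_nonneg z.2.2]
  refine Prod.ext (funext fun i => ?_) (Prod.ext h5 h6)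
  simpa using (Finset.sum_eq_zero_iff_of_nonneg fun i _ => sq_nonneg (z.1 i)).1 h4 i
    (Finset.mem_univ i)

lemma exists_confForm_ne_zero {n : ℕ} {z : ConfSpace n} (hz : z ≠ 0) :
    ∃ w, confForm n z w ≠ 0 := by
  contrapose! hz
  exact eq_zero_of_confForm_eq_zero hz

/-- The identification of the Freudenthal triple system with pairs of vectors of signature
`(2, n)`. -/
def pairEquiv (n : ℕ) : F n ≃ₗ[ℝ] ConfSpace n × ConfSpace n where
  toFun x := ((x.2.2.1.2, x.2.1, x.2.2.2.1),
    (fun i => lorentzSign i * x.2.2.2.2 i, x.2.2.1.1, x.1))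
  invFun z := (z.2.2.2, z.1.2.1, (z.2.2.1, z.1.1), (z.1.2.2, fun i => lorentzSign i * z.2.1 i))
  map_add' x y := by
    refine Prod.ext rfl (Prod.ext (funext fun i => ?_) rfl)
    simp [mul_add]
  map_smul' c x := by
    refine Prod.ext rfl (Prod.ext (funext fun i => ?_) rfl)
    simp [mul_left_comm]
  left_inv x := by simp [← mul_assoc, lorentzSign_mul_self]
  right_inv z := by simp [← mul_assoc, lorentzSign_mul_self]

/-- The symplectic form on pairs of vectors. -/
lemma symp_eq {n : ℕ} (x y : F n) :
    symp x y = 2 * (confForm n (pairEquiv n x).1 (pairEquiv n y).2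
      - confForm n (pairEquiv n x).2 (pairEquiv n y).1) := by
  have h : ∀ v w : Fin n → ℝ, ∑ i, lorentzSign i * (v i * (lorentzSign i * w i))
      = ∑ i, v i * w i := fun v w => Finset.sum_congr rfl fun i _ => by
    linear_combination v i * w i * lorentzSign_mul_self i
  have h' : ∀ v w : Fin n → ℝ, ∑ i, lorentzSign i * (lorentzSign i * w i * v i)
      = ∑ i, w i * v i := fun v w => Finset.sum_congr rfl fun i _ => by
    linear_combination v i * w i * lorentzSign_mul_self i
  simp only [symp, TrF, confForm_apply, pairEquiv, LinearEquiv.coe_mk, LinearMap.coe_mk,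
    AddHom.coe_mk, h, h']
  ring

/-- The quartic form is a Gram determinant on pairs of vectors. -/
lemma Dlt_eq {n : ℕ} (x : F n) :
    Dlt x = 4 * (confForm n (pairEquiv n x).1 (pairEquiv n x).1
        * confForm n (pairEquiv n x).2 (pairEquiv n x).2
      - confForm n (pairEquiv n x).1 (pairEquiv n x).2 ^ 2) := by
  have h : ∀ v w : Fin n → ℝ, ∑ i, lorentzSign i * (v i * (lorentzSign i * w i))
      = ∑ i, v i * w i := fun v w => Finset.sum_congr rfl fun i _ => by
    linear_combination v i * w i * lorentzSign_mul_self i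
  have hQ : ∀ v : Fin n → ℝ, ∑ i, lorentzSign i * (v i * v i) = Qf v := fun v =>
    Finset.sum_congr rfl fun i _ => by rw [sq]; rfl
  have hQ' : ∀ v : Fin n → ℝ, ∑ i, lorentzSign i * v i * v i = Qf v := fun v =>
    Finset.sum_congr rfl fun i _ => by rw [mul_assoc, ← sq]; rfl
  have hs : ∀ (a b : ℝ) (v w : Fin n → ℝ),
      ∑ i : Fin n, (if (i : ℕ) = 0 then a * v i else -(a * v i))
        * (if (i : ℕ) = 0 then b * w i else -(b * w i)) = a * b * ∑ i, v i * w i := by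
    intro a b v w
    rw [Finset.mul_sum]
    refine Finset.sum_congr rfl fun i _ => ?_
    split_ifs <;> ring
  simp only [Dlt, Nrm, sharp, TrF, confForm_apply, pairEquiv, LinearEquiv.coe_mk,
    LinearMap.coe_mk, AddHom.coe_mk, h, hQ, hQ', hs]
  ring

lemma deriv_zero_of_quartic {E : Type*} [NormedAddCommGroup E] [NormedSpace ℝ E] {f : ℝ → E}
    {c₀ c₁ c₂ c₃ : E} (c₄ : E)
    (h : ∀ s, f s = c₀ + s • c₁ + s ^ 2 • c₂ + s ^ 3 • c₃ + s ^ 4 • c₄) : deriv f 0 = c₁ := by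
  rw [funext h]
  have hp : ∀ k : ℕ, HasDerivAt (fun s : ℝ => s ^ k) (k * (0 : ℝ) ^ (k - 1)) 0 := fun k =>
    hasDerivAt_pow k 0
  have := (((((hasDerivAt_id (0 : ℝ)).smul_const c₁).const_add c₀).add
    ((hp 2).smul_const c₂)).add ((hp 3).smul_const c₃)).add ((hp 4).smul_const c₄)
  simpa [Pi.add_def] using this.deriv

/-- The triple product map on pairs of vectors. -/
noncomputable def pairTriple {n : ℕ} (z : ConfSpace n × ConfSpace n) :
    ConfSpace n × ConfSpace n :=
  ((2 : ℝ) • (confForm n z.1 z.1 • z.2 - confForm n z.1 z.2 • z.1),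
    (2 : ℝ) • (confForm n z.1 z.2 • z.2 - confForm n z.2 z.2 • z.1))

lemma symp_left_injective {n : ℕ} {x y : F n} (h : ∀ z, symp x z = symp y z) : x = y := by
  apply (pairEquiv n).injective
  rw [← sub_eq_zero]
  have h' : ∀ z : ConfSpace n × ConfSpace n,
      confForm n (pairEquiv n x - pairEquiv n y).1 z.2
        = confForm n (pairEquiv n x - pairEquiv n y).2 z.1 := fun z => by
    have := h ((pairEquiv n).symm z)
    simp only [symp_eq, LinearEquiv.apply_symm_apply] at this
    simp only [Prod.fst_sub, Prod.snd_sub, map_sub, LinearMap.sub_apply]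
    linarith
  refine Prod.ext (eq_zero_of_confForm_eq_zero fun w => ?_)
    (eq_zero_of_confForm_eq_zero fun w => ?_)
  · simpa using h' (0, w)
  · simpa using (h' (w, 0)).symm

lemma IsTripleMap.eq_pairTriple {n : ℕ} {T : F n → F n} (hT : IsTripleMap T) (x : F n) :
    T x = (pairEquiv n).symm (pairTriple (pairEquiv n x)) := by
  refine symp_left_injective fun z => ?_
  rw [hT, symp_eq, LinearEquiv.apply_symm_apply]
  generalize hp : pairEquiv n x = a
  generalize hq : pairEquiv n z = b
  obtain ⟨p, q⟩ := a
  obtain ⟨r, t⟩ := b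
  rw [deriv_zero_of_quartic
    (c₀ := 4 * (confForm n p p * confForm n q q - confForm n p q ^ 2))
    (c₁ := 8 * (confForm n p p * confForm n q t + confForm n p r * confForm n q q
      - confForm n p q * (confForm n p t + confForm n r q)))
    (c₂ := 4 * (confForm n p p * confForm n t t + 4 * (confForm n p r * confForm n q t)
      + confForm n r r * confForm n q q - (confForm n p t + confForm n r q) ^ 2
      - 2 * (confForm n p q * confForm n r t)))
    (c₃ := 8 * (confForm n p r * confForm n t t + confForm n r r * confForm n q t
      - confForm n r t * (confForm n p t + confForm n r q)))
    (4 * (confForm n r r * confForm n t t - confForm n r t ^ 2))]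
  · simp only [pairTriple, map_sub, map_smul, LinearMap.smul_apply,
      LinearMap.sub_apply, smul_eq_mul]
    rw [confForm_comm r q]
    ring
  · intro s
    simp only [Dlt_eq, map_add, map_smul, hp, hq, Prod.fst_add, Prod.snd_add, Prod.smul_fst,
      Prod.smul_snd, LinearMap.add_apply, LinearMap.smul_apply, smul_eq_mul]
    rw [confForm_comm r p, confForm_comm t q]
    ring

/-- The map `Υ` on pairs of vectors. -/
lemma Ups_eq {n : ℕ} {T : F n → F n} (hT : IsTripleMap T) (x : F n) (r t : ConfSpace n) :
    pairEquiv n (Ups T x ((pairEquiv n).symm (r, t))) =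
      ((4 * confForm n (pairEquiv n x).1 r) • (pairEquiv n x).2
        + (2 * confForm n (pairEquiv n x).1 (pairEquiv n x).1) • t
        - (4 * confForm n (pairEquiv n x).2 r) • (pairEquiv n x).1
        - (2 * confForm n (pairEquiv n x).1 (pairEquiv n x).2) • r,
      (4 * confForm n (pairEquiv n x).1 t) • (pairEquiv n x).2
        + (2 * confForm n (pairEquiv n x).1 (pairEquiv n x).2) • t
        - (4 * confForm n (pairEquiv n x).2 t) • (pairEquiv n x).1
        - (2 * confForm n (pairEquiv n x).2 (pairEquiv n x).2) • r) := by
  rw [Ups, symp_eq, LinearEquiv.apply_symm_apply]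
  obtain ⟨⟨p, q⟩, rfl⟩ := (pairEquiv n).symm.surjective x
  simp only [LinearEquiv.apply_symm_apply]
  rw [deriv_zero_of_quartic
    (c₀ := (pairEquiv n).symm (pairTriple (p, q)))
    (c₁ := (pairEquiv n).symm
      ((2 : ℝ) • ((2 * confForm n p r) • q + confForm n p p • t
        - (confForm n p t + confForm n q r) • p - confForm n p q • r),
      (2 : ℝ) • ((confForm n p t + confForm n q r) • q + confForm n p q • t
        - (2 * confForm n q t) • p - confForm n q q • r)))
    (c₂ := (pairEquiv n).symm
      ((2 : ℝ) • (confForm n r r • q + (2 * confForm n p r) • t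
        - confForm n r t • p - (confForm n p t + confForm n q r) • r),
      (2 : ℝ) • (confForm n r t • q + (confForm n p t + confForm n q r) • t
        - confForm n t t • p - (2 * confForm n q t) • r)))
    (c₃ := (pairEquiv n).symm (pairTriple (r, t))) 0]
  · rw [map_add, map_smul, LinearEquiv.apply_symm_apply, LinearEquiv.apply_symm_apply]
    ext1
    · simp only [Prod.fst_add, Prod.smul_fst]
      module
    · simp only [Prod.snd_add, Prod.smul_snd]
      module
  · intro s
    apply (pairEquiv n).injective
    simp only [hT.eq_pairTriple, map_add, map_smul, LinearEquiv.apply_symm_apply, smul_zero,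
      add_zero]
    ext1
    · simp only [pairTriple, Prod.fst_add, Prod.snd_add, Prod.smul_fst, Prod.smul_snd, map_add,
        map_smul, LinearMap.add_apply, LinearMap.smul_apply, smul_eq_mul]
      rw [confForm_comm r p, confForm_comm r q]
      module
    · simp only [pairTriple, Prod.fst_add, Prod.snd_add, Prod.smul_fst, Prod.smul_snd, map_add,
        map_smul, LinearMap.add_apply, LinearMap.smul_apply, smul_eq_mul]
      rw [confForm_comm t q, confForm_comm r q]
      module

lemma AutRel.trans {n : ℕ} {x y z : F n} (h : AutRel x y) (h' : AutRel y z) : AutRel x z := by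
  obtain ⟨σ, ⟨hb, hl, hs, hd⟩, rfl⟩ := h
  obtain ⟨τ, ⟨hb', hl', hs', hd'⟩, rfl⟩ := h'
  refine ⟨τ ∘ σ, ⟨hb'.comp hb, ((hl'.mk' τ).comp (hl.mk' σ)).isLinear, fun x y => ?_,
    fun x => ?_⟩, rfl⟩
  · simp [hs', hs]
  · simp [hd', hd]

/-- A linear automorphism of the space of pairs preserving the forms induces an automorphism. -/
lemma autRel_of_linearEquiv {n : ℕ}
    (e : (ConfSpace n × ConfSpace n) ≃ₗ[ℝ] (ConfSpace n × ConfSpace n))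
    (hs : ∀ z w, confForm n (e z).1 (e w).2 - confForm n (e z).2 (e w).1
      = confForm n z.1 w.2 - confForm n z.2 w.1)
    (hd : ∀ z, confForm n (e z).1 (e z).1 * confForm n (e z).2 (e z).2
        - confForm n (e z).1 (e z).2 ^ 2
      = confForm n z.1 z.1 * confForm n z.2 z.2 - confForm n z.1 z.2 ^ 2)
    (z : ConfSpace n × ConfSpace n) :
    AutRel ((pairEquiv n).symm z) ((pairEquiv n).symm (e z)) := by
  let τ := ((pairEquiv n).trans e).trans (pairEquiv n).symm
  refine ⟨τ, ⟨τ.bijective, τ.toLinearMap.isLinear, fun x y => ?_, fun x => ?_⟩, ?_⟩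
  · simp [τ, symp_eq, hs]
  · simp [τ, Dlt_eq, hd]
  · simp [τ]

/-- The special linear transformation `(p, q) ↦ (q - c p, -p)`. -/
def shearSwap (n : ℕ) (c : ℝ) :
    (ConfSpace n × ConfSpace n) ≃ₗ[ℝ] (ConfSpace n × ConfSpace n) where
  toFun z := (z.2 - c • z.1, -z.1)
  invFun z := (-z.2, z.1 - c • z.2)
  map_add' x y := by
    ext1
    · simp only [Prod.fst_add, Prod.snd_add]; module
    · simp only [Prod.fst_add, Prod.snd_add]; module
  map_smul' c x := by
    ext1
    · simp only [Prod.smul_fst, Prod.smul_snd, RingHom.id_apply]; module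
    · simp only [Prod.smul_fst, Prod.smul_snd, RingHom.id_apply]; module
  left_inv x := by simp
  right_inv x := by simp

lemma autRel_shearSwap {n : ℕ} (c : ℝ) (p q : ConfSpace n) :
    AutRel ((pairEquiv n).symm (p, q)) ((pairEquiv n).symm (q - c • p, -p)) := by
  refine autRel_of_linearEquiv (shearSwap n c) (fun z w => ?_) (fun z => ?_) (p, q)
  · simp only [shearSwap, LinearEquiv.coe_mk, LinearMap.coe_mk, AddHom.coe_mk, map_sub, map_neg,
      map_smul, LinearMap.sub_apply, LinearMap.neg_apply, LinearMap.smul_apply, smul_eq_mul]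
    ring
  · simp only [shearSwap, LinearEquiv.coe_mk, LinearMap.coe_mk, AddHom.coe_mk, map_sub, map_neg,
      map_smul, LinearMap.sub_apply, LinearMap.neg_apply, LinearMap.smul_apply, smul_eq_mul]
    rw [confForm_comm z.2 z.1]
    ring

/-- The reflection in a non-isotropic vector. -/
noncomputable def confReflection {n : ℕ} (m : ConfSpace n) : ConfSpace n →ₗ[ℝ] ConfSpace n :=
  LinearMap.id - (2 / confForm n m m) • (confForm n m).smulRight m

lemma confReflection_apply {n : ℕ} (m z : ConfSpace n) :
    confReflection m z = z - (2 / confForm n m m * confForm n m z) • m := by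
  simp [confReflection, mul_smul]

lemma confForm_confReflection {n : ℕ} {m : ConfSpace n} (hm : confForm n m m ≠ 0)
    (z w : ConfSpace n) :
    confForm n (confReflection m z) (confReflection m w) = confForm n z w := by
  simp only [confReflection_apply, map_sub, map_smul, LinearMap.sub_apply, LinearMap.smul_apply,
    smul_eq_mul]
  rw [confForm_comm z m]
  field_simp
  ring

lemma confReflection_involutive {n : ℕ} {m : ConfSpace n} (hm : confForm n m m ≠ 0) :
    Function.Involutive (confReflection m) := fun z => by
  have h : 2 / confForm n m m * confForm n m m = 2 := div_mul_cancel₀ 2 hm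
  simp only [confReflection_apply, map_sub, map_smul, h]
  module

lemma autRel_of_confForm_ne_zero {n : ℕ} {z e : ConfSpace n} (hz : confForm n z z = 0)
    (he : confForm n e e = 0) (hze : confForm n z e ≠ 0) :
    AutRel ((pairEquiv n).symm (0, z)) ((pairEquiv n).symm (0, e)) := by
  have hmm : confForm n (z - e) (z - e) = -2 * confForm n z e := by
    simp only [map_sub, LinearMap.sub_apply, hz, he, confForm_comm e z]
    ring
  have hm : confForm n (z - e) (z - e) ≠ 0 := by
    rw [hmm]
    simpa using hze
  have hr : confReflection (z - e) z = e := by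
    rw [confReflection_apply, hmm]
    simp only [map_sub, LinearMap.sub_apply, hz, confForm_comm e z]
    have : 2 / (-2 * confForm n z e) * (0 - confForm n z e) = 1 := by
      field_simp
      ring
    rw [this]
    module
  let ρ := LinearEquiv.ofInvolutive (confReflection (z - e)) (confReflection_involutive hm)
  have hρ : ∀ y, ρ y = confReflection (z - e) y := fun _ => rfl
  have := autRel_of_linearEquiv (ρ.prodCongr ρ)
    (fun a b => by simp [hρ, confForm_confReflection hm])
    (fun a => by simp [hρ, confForm_confReflection hm]) (0, z)
  simpa [hρ, hr] using this

/-- The isotropic vector corresponding to the canonical form of rank one. -/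
def confBase (n : ℕ) : ConfSpace n := (0, 0, 1)

lemma autRel_confBase {n : ℕ} {z : ConfSpace n} (hz0 : z ≠ 0) (hz : confForm n z z = 0) :
    AutRel ((pairEquiv n).symm (0, z)) ((pairEquiv n).symm (0, confBase n)) := by
  have hbase : ∀ w : ConfSpace n, confForm n w (confBase n) = -w.2.1 / 2 := fun w => by
    simp [confForm_apply, confBase]
    ring
  have hb : confForm n (confBase n) (confBase n) = 0 := by
    rw [hbase]
    simp [confBase]
  by_cases hs : z.2.1 = 0
  · obtain ⟨u, hu⟩ : ∃ u : Fin n → ℝ,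
        ∑ i, lorentzSign i * (z.1 i * u i) - z.2.2 / 2 ≠ 0 := by
      by_contra! h
      apply hz0
      have ht : z.2.2 = 0 := by simpa using h 0
      refine eq_zero_of_confForm_eq_zero fun w => ?_
      have := h w.1
      simp only [confForm_apply, hs, ht] at this ⊢
      linarith
    let w : ConfSpace n := (u, 1, ∑ i, lorentzSign i * (u i * u i))
    have hw : confForm n w w = 0 := by
      simp [confForm_apply, w]
    refine (autRel_of_confForm_ne_zero hz hw ?_).trans (autRel_of_confForm_ne_zero hw hb ?_)
    · simpa [confForm_apply, w, hs] using hu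
    · simp [hbase, w]
  · exact autRel_of_confForm_ne_zero hz hb (by simpa [hbase] using hs)

/-- every rank-1 element of `F^{2,n}` (`x ≠ 0` and `Υ(x, y) = 0` for all `y`)
is `Aut`-related to `x₁ = (1, 0, 0, 0)`. -/
theorem fts_rank1_orbit (n : ℕ) (hn : 2 ≤ n) (T : F n → F n) (hT : IsTripleMap T)
    (x : F n) (hx : x ≠ 0) (h1 : ∀ y, Ups T x y = 0) :
    AutRel x (1, 0, 0, 0) := by
  have hU : ∀ r t : ConfSpace n, pairEquiv n (Ups T x ((pairEquiv n).symm (r, t))) = 0 :=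
    fun r t => by rw [h1, map_zero]
  simp only [Ups_eq hT] at hU
  have hbase : ((1, 0, 0, 0) : F n) = (pairEquiv n).symm (0, confBase n) := by
    ext <;> simp [pairEquiv, confBase]
  rw [hbase]
  obtain ⟨⟨p, q⟩, rfl⟩ := (pairEquiv n).symm.surjective x
  simp only [LinearEquiv.apply_symm_apply] at hU
  have hb0 : confBase n ≠ 0 := fun h => by simpa [confBase] using congrArg (·.2.2) h
  have hpp : confForm n p p = 0 := by
    have := congrArg Prod.fst (hU 0 (confBase n))
    simpa [hb0] using this
  have hqq : confForm n q q = 0 := by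
    have := congrArg Prod.snd (hU (confBase n) 0)
    simpa [hb0] using this
  by_cases hp : p = 0
  · subst hp
    refine autRel_confBase (fun hq => hx ?_) hqq
    rw [hq]
    exact map_zero _
  have hpq : confForm n p q = 0 := by
    have h : (4 * confForm n p p) • q + (2 * confForm n p p) • (0 : ConfSpace n)
        - (4 * confForm n q p) • p - (2 * confForm n p q) • p = 0 :=
      congrArg Prod.fst (hU p 0)
    rw [hpp, confForm_comm q p] at h
    have h' : (-6 * confForm n p q) • p = 0 := by
      rw [← h]
      module
    simpa [hp] using h'
  obtain ⟨r, hr⟩ := exists_confForm_ne_zero hp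
  have hq : q - (confForm n q r / confForm n p r) • p = 0 := by
    have h : (4 * confForm n p r) • q + (2 * confForm n p p) • (0 : ConfSpace n)
        - (4 * confForm n q r) • p - (2 * confForm n p q) • r = 0 :=
      congrArg Prod.fst (hU r 0)
    rw [hpq] at h
    have h' : (4 * confForm n p r) • (q - (confForm n q r / confForm n p r) • p) = 0 := by
      rw [smul_sub, smul_smul, ← h,
        show 4 * confForm n p r * (confForm n q r / confForm n p r) = 4 * confForm n q r by
          field_simp]
      module
    simpa [hr] using h'
  have h := autRel_shearSwap (confForm n q r / confForm n p r) p q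
  rw [hq] at h
  exact h.trans (autRel_confBase (neg_ne_zero.2 hp) (by simpa using hpp))
end

section
/- Let n ≥ 2. Every rank-3 element of F^{2,n}, i.e. every x with Δ(x) = 0 and T(x) ≠ 0, is Aut-related to one of the canonical forms x_{3a} = (1, 0, (0; 1, 0, …, 0), 0) or x_{3b} = (1, 0, (0; 0, 1, 0, …, 0), 0). -/
open Real Matrix

section PairsOfVectors

/-- The alternating form on `V × V` induced by a bilinear form on `V`. -/
def pairForm {V : Type*} [AddCommGroup V] [Module ℝ V] (B : LinearMap.BilinForm ℝ V)
    (p q : V × V) : ℝ :=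
  B p.1 q.2 - B q.1 p.2

/-- The Gram determinant of a pair of vectors. -/
def gramDet {V : Type*} [AddCommGroup V] [Module ℝ V] (B : LinearMap.BilinForm ℝ V)
    (p : V × V) : ℝ :=
  B p.1 p.1 * B p.2 p.2 - B p.1 p.2 ^ 2

/-- Two pairs are related by a linear automorphism of `V × V` preserving `pairForm` and
`gramDet`. -/
def PairRel {V : Type*} [AddCommGroup V] [Module ℝ V] (B : LinearMap.BilinForm ℝ V)
    (p q : V × V) : Prop :=
  ∃ g : (V × V) ≃ₗ[ℝ] (V × V), (∀ x y, pairForm B (g x) (g y) = pairForm B x y) ∧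
    (∀ x, gramDet B (g x) = gramDet B x) ∧ g p = q

theorem PairRel.trans {V : Type*} [AddCommGroup V] [Module ℝ V] {B : LinearMap.BilinForm ℝ V}
    {p q r : V × V} (h : PairRel B p q) (h' : PairRel B q r) : PairRel B p r := by
  obtain ⟨g, hg, hd, rfl⟩ := h
  obtain ⟨k, hk, he, rfl⟩ := h'
  exact ⟨g.trans k, fun x y => by simp [hk, hg], fun x => by simp [he, hd], rfl⟩

/-- The action of `SL(2, ℝ)` on pairs of vectors. -/
def slPair (V : Type*) [AddCommGroup V] [Module ℝ V] (a b c d : ℝ) (h : a * d - b * c = 1) :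
    (V × V) ≃ₗ[ℝ] (V × V) where
  toFun p := (a • p.1 + b • p.2, c • p.1 + d • p.2)
  invFun p := (d • p.1 - b • p.2, a • p.2 - c • p.1)
  map_add' p q := by ext <;> simp <;> module
  map_smul' t p := by ext <;> simp <;> module
  left_inv p := by
    ext
    · linear_combination (norm := (simp; module)) h • p.1
    · linear_combination (norm := (simp; module)) h • p.2
  right_inv p := by
    ext
    · linear_combination (norm := (simp; module)) h • p.1
    · linear_combination (norm := (simp; module)) h • p.2

theorem pairRel_sl {V : Type*} [AddCommGroup V] [Module ℝ V] {B : LinearMap.BilinForm ℝ V}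
    (hB : ∀ u w, B u w = B w u) (P R : V) (a b c d : ℝ) (h : a * d - b * c = 1) :
    PairRel B (P, R) (a • P + b • R, c • P + d • R) := by
  refine ⟨slPair V a b c d h, fun x y => ?_, fun x => ?_, rfl⟩
  · simp only [slPair, pairForm, LinearEquiv.coe_mk, LinearMap.coe_mk, AddHom.coe_mk, map_add,
      map_smul, LinearMap.add_apply, LinearMap.smul_apply, smul_eq_mul]
    rw [hB y.1 x.1, hB y.2 x.1, hB y.2 x.2, hB y.1 x.2]
    linear_combination (B x.1 y.2 - B x.2 y.1) * h
  · simp only [slPair, gramDet, LinearEquiv.coe_mk, LinearMap.coe_mk, AddHom.coe_mk, map_add,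
      map_smul, LinearMap.add_apply, LinearMap.smul_apply, smul_eq_mul]
    rw [hB x.2 x.1]
    linear_combination (a * d - b * c + 1) * (B x.1 x.1 * B x.2 x.2 - B x.1 x.2 ^ 2) * h

theorem pairRel_isometry {V : Type*} [AddCommGroup V] [Module ℝ V] {B : LinearMap.BilinForm ℝ V}
    (φ : V ≃ₗ[ℝ] V) (hφ : ∀ u w, B (φ u) (φ w) = B u w) (P R : V) :
    PairRel B (P, R) (φ P, φ R) :=
  ⟨φ.prodCongr φ, fun x y => by simp [pairForm, hφ], fun x => by simp [gramDet, hφ], rfl⟩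

/-- If `u` and `w` have the same norm and `u - w` is anisotropic, then the reflection in `u - w`
is an isometry taking `u` to `w`. -/
theorem exists_isometry_of_sub {V : Type*} [AddCommGroup V] [Module ℝ V]
    {B : LinearMap.BilinForm ℝ V} (hB : ∀ u w, B u w = B w u) {u w : V} (h : B u u = B w w)
    (hne : B (u - w) (u - w) ≠ 0) :
    ∃ φ : V ≃ₗ[ℝ] V, (∀ x y, B (φ x) (φ y) = B x y) ∧ φ u = w ∧
      ∀ z, B (u - w) z = 0 → φ z = z := by
  obtain ⟨a, ha⟩ : ∃ a, a = u - w := ⟨_, rfl⟩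
  rw [← ha] at hne ⊢
  let f : V →ₗ[ℝ] V := LinearMap.id - (2 / B a a) • (B a).smulRight a
  have hf : ∀ x, f x = x - (2 / B a a * B a x) • a := fun x => by simp [f, smul_smul]
  have hinv : Function.Involutive f := fun x => by
    rw [hf (f x), hf x, map_sub, map_smul, smul_eq_mul, sub_sub, ← add_smul]
    have : 2 / B a a * B a x + 2 / B a a * (B a x - 2 / B a a * B a x * B a a) = 0 := by
      field_simp
      ring
    rw [this, zero_smul, sub_zero]
  refine ⟨LinearEquiv.ofInvolutive f hinv, fun x y => ?_, ?_, fun z hz => ?_⟩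
  · simp only [LinearEquiv.coe_ofInvolutive, hf, map_sub, map_smul, LinearMap.sub_apply,
      LinearMap.smul_apply, smul_eq_mul]
    rw [hB x a]
    field_simp
    ring
  · have h2 : 2 * B a u = B a a := by
      simp only [ha, map_sub, LinearMap.sub_apply]
      rw [hB w u]
      linarith
    have h3 : 2 / B a a * B a u = 1 := by
      field_simp
      exact h2
    rw [LinearEquiv.coe_ofInvolutive, hf, h3, one_smul, ha, sub_sub_cancel]
  · simp [hf, hz]

/-- Isometries act transitively on the vectors of a given nonzero norm. -/
theorem exists_isometry_of_eq {V : Type*} [AddCommGroup V] [Module ℝ V]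
    {B : LinearMap.BilinForm ℝ V} (hB : ∀ u w, B u w = B w u) {u w : V} (h : B u u = B w w)
    (hne : B u u ≠ 0) :
    ∃ φ : V ≃ₗ[ℝ] V, (∀ x y, B (φ x) (φ y) = B x y) ∧ φ u = w := by
  by_cases h1 : B (u - w) (u - w) = 0
  · have h2 : B (u - -w) (u - -w) ≠ 0 := by
      simp only [map_sub, map_neg, LinearMap.sub_apply, LinearMap.neg_apply] at h1 ⊢
      intro h3
      apply hne
      linarith
    obtain ⟨φ, hφ, hu, -⟩ := exists_isometry_of_sub hB (by simpa using h) h2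
    exact ⟨φ.trans (LinearEquiv.neg ℝ), fun x y => by simp [hφ], by simp [hu]⟩
  · obtain ⟨φ, hφ, hu, -⟩ := exists_isometry_of_sub hB h h1
    exact ⟨φ, hφ, hu⟩

/-- Two non-orthogonal null vectors orthogonal to `e` are exchanged by an isometry fixing `e`. -/
theorem exists_isometry_null {V : Type*} [AddCommGroup V] [Module ℝ V]
    {B : LinearMap.BilinForm ℝ V} (hB : ∀ u w, B u w = B w u) {e u w : V} (hu : B u u = 0)
    (hw : B w w = 0) (hue : B u e = 0) (hwe : B w e = 0) (h : B u w ≠ 0) :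
    ∃ φ : V ≃ₗ[ℝ] V, (∀ x y, B (φ x) (φ y) = B x y) ∧ φ e = e ∧ φ u = w := by
  have hne : B (u - w) (u - w) ≠ 0 := by
    simp only [map_sub, LinearMap.sub_apply, hB w u, hu, hw]
    contrapose! h
    linarith
  obtain ⟨φ, hφ, h1, h2⟩ := exists_isometry_of_sub hB (hu.trans hw.symm) hne
  exact ⟨φ, hφ, h2 e (by simp [hue, hwe]), h1⟩

/-- A pair with degenerate Gram matrix and nonvanishing gradient of the Gram determinant is related
to a pair of an anisotropic vector of norm `±1` and an orthogonal nonzero null vector. -/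
theorem exists_pairRel_of_gramDet_eq_zero {V : Type*} [AddCommGroup V] [Module ℝ V]
    {B : LinearMap.BilinForm ℝ V} (hB : ∀ u w, B u w = B w u) {P R : V}
    (h : gramDet B (P, R) = 0)
    (hgrad : ¬ (B R R • P = B P R • R ∧ B P P • R = B P R • P)) :
    ∃ P' R' : V, PairRel B (P, R) (P', R') ∧ (B P' P' = 1 ∨ B P' P' = -1) ∧ B P' R' = 0 ∧
      B R' R' = 0 ∧ R' ≠ 0 := by
  simp only [gramDet] at h
  have key : ∃ P₁ R₁ : V, PairRel B (P, R) (P₁, R₁) ∧ B P₁ P₁ ≠ 0 ∧ B P₁ R₁ = 0 ∧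
      B R₁ R₁ = 0 ∧ R₁ ≠ 0 := by
    by_cases hP : B P P = 0
    · have hPR : B P R = 0 := by simpa [hP] using h
      have hgrad' : ¬ B R R • P = 0 := by simpa [hP, hPR] using hgrad
      rw [smul_eq_zero, not_or] at hgrad'
      refine ⟨_, _, pairRel_sl hB P R 0 1 (-1) 0 (by norm_num), ?_, ?_, ?_, ?_⟩
      · simpa using hgrad'.1
      · simpa [hB R P] using hPR
      · simpa using hP
      · simpa using hgrad'.2
    · refine ⟨_, _, pairRel_sl hB P R 1 0 (-(B P R / B P P)) 1 (by norm_num), ?_, ?_, ?_, ?_⟩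
      · simpa using hP
      · simp
        field_simp
        ring
      · simp [hB R P]
        field_simp
        linear_combination h
      · intro h0
        have hR : R = (B P R / B P P) • P := by
          linear_combination (norm := module) h0
        apply hgrad
        set c := B P R / B P P with hc
        rw [hR]
        simp only [map_smul, LinearMap.smul_apply, smul_eq_mul]
        constructor <;> module
  obtain ⟨P₁, R₁, hrel, h1, h2, h3, h4⟩ := key
  have hs : √|B P₁ P₁| ≠ 0 := (Real.sqrt_pos.2 (abs_pos.2 h1)).ne'
  have hss : √|B P₁ P₁| * √|B P₁ P₁| = |B P₁ P₁| := Real.mul_self_sqrt (abs_nonneg _)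
  refine ⟨_, _, hrel.trans (pairRel_sl hB P₁ R₁ (√|B P₁ P₁|)⁻¹ 0 0 (√|B P₁ P₁|)
    (by simp [hs])), ?_, ?_, ?_, ?_⟩
  · have : B ((√|B P₁ P₁|)⁻¹ • P₁ + (0 : ℝ) • R₁) ((√|B P₁ P₁|)⁻¹ • P₁ + (0 : ℝ) • R₁) =
        B P₁ P₁ / |B P₁ P₁| := by
      simp only [zero_smul, add_zero, map_smul, LinearMap.smul_apply, smul_eq_mul]
      rw [← mul_assoc, ← mul_inv, hss, inv_mul_eq_div]
    rw [this]
    rcases lt_or_gt_of_ne h1 with hlt | hgt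
    · right
      rw [abs_of_neg hlt, div_neg, div_self h1]
    · left
      rw [abs_of_pos hgt, div_self h1]
  · simp [h2]
  · simp [h3]
  · simp [hs, h4]

end PairsOfVectors

section ConcreteModel

/-- The sign of the `i`-th coordinate in the Lorentzian form. -/
def sgn {n : ℕ} (i : Fin n) : ℝ := if (i : ℕ) = 0 then 1 else -1

theorem sgn_mul_sgn {n : ℕ} (i : Fin n) : sgn i * sgn i = 1 := by
  unfold sgn
  split_ifs <;> norm_num

/-- The bilinear form of signature `(2, n)` on `ℝⁿ ⊕ ℝ²`. -/
noncomputable def bil (n : ℕ) : LinearMap.BilinForm ℝ ((Fin n → ℝ) × ℝ × ℝ) :=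
  LinearMap.mk₂ ℝ
    (fun u w => ∑ i, sgn i * u.1 i * w.1 i - (u.2.1 * w.2.2 + u.2.2 * w.2.1) / 2)
    (fun u u' w => by
      simp only [Prod.fst_add, Prod.snd_add, Pi.add_apply, mul_add, add_mul,
        Finset.sum_add_distrib]
      ring)
    (fun c u w => by
      simp only [Prod.smul_fst, Prod.smul_snd, Pi.smul_apply, smul_eq_mul, mul_sub,
        Finset.mul_sum]
      congr 1
      · exact Finset.sum_congr rfl fun i _ => by ring
      · ring)
    (fun u w w' => by
      simp only [Prod.fst_add, Prod.snd_add, Pi.add_apply, mul_add,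
        Finset.sum_add_distrib]
      ring)
    (fun c u w => by
      simp only [Prod.smul_fst, Prod.smul_snd, Pi.smul_apply, smul_eq_mul, mul_sub,
        Finset.mul_sum]
      congr 1
      · exact Finset.sum_congr rfl fun i _ => by ring
      · ring)

theorem bil_apply {n : ℕ} (u w : (Fin n → ℝ) × ℝ × ℝ) :
    bil n u w = ∑ i, sgn i * u.1 i * w.1 i - (u.2.1 * w.2.2 + u.2.2 * w.2.1) / 2 := rfl

theorem bil_comm {n : ℕ} (u w : (Fin n → ℝ) × ℝ × ℝ) : bil n u w = bil n w u := by
  rw [bil_apply, bil_apply]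
  congr 1
  · exact Finset.sum_congr rfl fun i _ => by ring
  · ring

/-- The triple system as the space of pairs of vectors in `ℝ^{2,n}`. -/
noncomputable def toPair (n : ℕ) :
    F n ≃ₗ[ℝ] ((Fin n → ℝ) × ℝ × ℝ) × ((Fin n → ℝ) × ℝ × ℝ) where
  toFun x := ((x.2.2.1.2, x.2.2.2.1, x.2.1), (fun i => sgn i * x.2.2.2.2 i, x.1, x.2.2.1.1))
  invFun p := (p.2.2.1, p.1.2.2, (p.2.2.2, p.1.1), (p.1.2.1, fun i => sgn i * p.2.1 i))
  map_add' x y := by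
    ext <;> simp [mul_add]
  map_smul' c x := by
    ext <;> simp [mul_left_comm]
  left_inv x := by
    ext <;> simp [← mul_assoc, sgn_mul_sgn]
  right_inv p := by
    ext <;> simp [← mul_assoc, sgn_mul_sgn]

theorem toPair_apply {n : ℕ} (x : F n) : toPair n x =
    ((x.2.2.1.2, x.2.2.2.1, x.2.1), (fun i => sgn i * x.2.2.2.2 i, x.1, x.2.2.1.1)) := rfl

theorem symp_eq_pairForm {n : ℕ} (x y : F n) :
    symp x y = 2 * pairForm (bil n) (toPair n x) (toPair n y) := by
  have h : ∀ v w : Fin n → ℝ, ∑ i, sgn i * v i * (sgn i * w i) = ∑ i, v i * w i := fun v w =>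
    Finset.sum_congr rfl fun i _ => by linear_combination v i * w i * sgn_mul_sgn i
  simp only [symp, TrF, pairForm, toPair_apply, bil_apply, h]
  rw [show ∑ i, x.2.2.2.2 i * y.2.2.1.2 i = ∑ i, y.2.2.1.2 i * x.2.2.2.2 i from
    Finset.sum_congr rfl fun i _ => mul_comm _ _]
  ring

theorem Dlt_eq_gramDet {n : ℕ} (x : F n) : Dlt x = 4 * gramDet (bil n) (toPair n x) := by
  have h : ∀ v w : Fin n → ℝ, ∑ i, sgn i * v i * (sgn i * w i) = ∑ i, v i * w i := fun v w =>
    Finset.sum_congr rfl fun i _ => by linear_combination v i * w i * sgn_mul_sgn i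
  have hQ : ∀ v : Fin n → ℝ, Qf v = ∑ i, sgn i * v i * v i := fun v =>
    Finset.sum_congr rfl fun i _ => by simp only [sgn]; ring
  have hQ' : ∀ v : Fin n → ℝ, ∑ i, sgn i * (sgn i * v i) * (sgn i * v i) = Qf v := fun v => by
    rw [hQ]
    exact Finset.sum_congr rfl fun i _ => by linear_combination sgn i * v i ^ 2 * sgn_mul_sgn i
  have hsharp : ∀ A : J n, sharp A = (Qf A.2, fun i => A.1 * (sgn i * A.2 i)) := fun A => by
    ext i
    · rfl
    · simp only [sharp, sgn]
      split_ifs <;> ring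
  have hs : ∀ (a b : ℝ) (v w : Fin n → ℝ),
      ∑ i, a * (sgn i * v i) * (b * (sgn i * w i)) = a * b * ∑ i, v i * w i := fun a b v w => by
    rw [Finset.mul_sum]
    exact Finset.sum_congr rfl fun i _ => by
      linear_combination a * b * v i * w i * sgn_mul_sgn i
  simp only [Dlt, Nrm, TrF, gramDet, toPair_apply, bil_apply, hQ', hsharp, hs]
  rw [← hQ]
  simp only [h]
  ring

theorem autRel_of_pairRel {n : ℕ} {x y : F n}
    (h : PairRel (bil n) (toPair n x) (toPair n y)) : AutRel x y := by
  obtain ⟨g, hg, hd, hxy⟩ := h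
  let σ : F n ≃ₗ[ℝ] F n := (toPair n).trans (g.trans (toPair n).symm)
  have hσ : ∀ z, toPair n (σ z) = g (toPair n z) := fun z => by simp [σ]
  refine ⟨σ, ⟨σ.bijective, σ.toLinearMap.isLinear, fun z w => ?_, fun z => ?_⟩, ?_⟩
  · rw [symp_eq_pairForm, symp_eq_pairForm, hσ, hσ, hg]
  · rw [Dlt_eq_gramDet, Dlt_eq_gramDet, hσ, hd]
  · exact (toPair n).injective ((hσ x).trans hxy)

theorem symp_nondegenerate {n : ℕ} {x : F n} (h : ∀ z, symp x z = 0) : x = 0 := by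
  have h0 : ∀ P' R', pairForm (bil n) (toPair n x) (P', R') = 0 := fun P' R' => by
    have := h ((toPair n).symm (P', R'))
    rw [symp_eq_pairForm, LinearEquiv.apply_symm_apply] at this
    linarith
  have hb : ∀ u : (Fin n → ℝ) × ℝ × ℝ, (∀ w, bil n u w = 0) → u = 0 := fun u hu => by
    have h1 := hu (0, 1, 0)
    have h2 := hu (0, 0, 1)
    have h3 := fun i => hu (Pi.single i 1, 0, 0)
    simp only [bil_apply, Pi.single_apply, mul_ite, mul_one, mul_zero, Finset.sum_ite_eq',
      Finset.mem_univ, if_true, Pi.zero_apply, Finset.sum_const_zero] at h1 h2 h3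
    ext i
    · have := h3 i
      have hi := sgn_mul_sgn i
      simp only [Prod.fst_zero, Pi.zero_apply]
      linear_combination sgn i * this - u.1 i * hi
    · simp only [Prod.fst_zero, Prod.snd_zero]
      linarith
    · simp only [Prod.snd_zero]
      linarith
  apply (toPair n).injective
  rw [map_zero]
  refine Prod.ext (hb _ fun w => ?_) (hb _ fun w => ?_)
  · simpa [pairForm] using h0 0 w
  · simpa [pairForm, bil_comm w] using h0 w 0

theorem deriv_Dlt {n : ℕ} (x z : F n) {P R P' R' : (Fin n → ℝ) × ℝ × ℝ}
    (hx : toPair n x = (P, R)) (hz : toPair n z = (P', R')) :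
    deriv (fun s : ℝ => Dlt (x + s • z)) 0 =
      8 * (bil n (bil n R R • P - bil n P R • R) P' + bil n (bil n P P • R - bil n P R • P) R')
      := by
  have h : (fun s : ℝ => Dlt (x + s • z)) = fun s : ℝ => 4 * (
      (bil n P P + s * (2 * bil n P P') + s ^ 2 * bil n P' P') *
        (bil n R R + s * (2 * bil n R R') + s ^ 2 * bil n R' R') -
      (bil n P R + s * (bil n P R' + bil n R P') + s ^ 2 * bil n P' R') ^ 2) := by
    funext s
    rw [Dlt_eq_gramDet, map_add, map_smul, hx, hz]
    simp only [gramDet, Prod.smul_mk, Prod.mk_add_mk, map_add, map_smul, LinearMap.add_apply,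
      LinearMap.smul_apply, smul_eq_mul]
    rw [bil_comm P' P, bil_comm R' R, bil_comm P' R]
    ring
  have hq : ∀ a b c : ℝ, HasDerivAt (fun s : ℝ => a + s * b + s ^ 2 * c) b 0 := fun a b c => by
    refine HasDerivAt.congr_deriv ((((hasDerivAt_id' (0 : ℝ)).mul_const b).const_add a).add
      (((hasDerivAt_id' (0 : ℝ)).pow 2).mul_const c)) ?_
    simp
  rw [h]
  refine HasDerivAt.deriv ?_
  refine HasDerivAt.congr_deriv
    ((((hq _ _ _).mul (hq _ _ _)).sub ((hq _ _ _).pow 2)).const_mul 4) ?_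
  simp only [map_sub, map_smul, LinearMap.sub_apply, LinearMap.smul_apply, smul_eq_mul]
  simp
  ring

/-- The stabilizer of a coordinate vector `e` acts transitively on the nonzero null vectors
orthogonal to `e`. -/
theorem exists_isometry_fixing {n : ℕ} {e : Fin n → ℝ} {c : ℝ} (he : ∀ i, sgn i * e i = c * e i)
    {R : (Fin n → ℝ) × ℝ × ℝ} (hR : bil n R R = 0) (hRe : bil n R (e, 0, 0) = 0) (h0 : R ≠ 0) :
    ∃ φ : ((Fin n → ℝ) × ℝ × ℝ) ≃ₗ[ℝ] ((Fin n → ℝ) × ℝ × ℝ),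
      (∀ x y, bil n (φ x) (φ y) = bil n x y) ∧ φ (e, 0, 0) = (e, 0, 0) ∧ φ R = (0, 1, 0) := by
  obtain ⟨r, p, q⟩ := R
  have hN : bil n ((0, 1, 0) : (Fin n → ℝ) × ℝ × ℝ) (0, 1, 0) = 0 := by simp [bil_apply]
  have hNe : bil n ((0, 1, 0) : (Fin n → ℝ) × ℝ × ℝ) (e, 0, 0) = 0 := by simp [bil_apply]
  by_cases hq : q = 0
  · subst hq
    obtain ⟨t, ht, htp⟩ : ∃ t : ℝ, t ≠ 0 ∧ p * t = -|p| := by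
      rcases le_total 0 p with hp | hp
      · exact ⟨-1, by norm_num, by rw [abs_of_nonneg hp]; ring⟩
      · exact ⟨1, by norm_num, by rw [abs_of_nonpos hp]; ring⟩
    let S : (Fin n → ℝ) × ℝ × ℝ := (fun i => sgn i * r i, 0, t)
    have hS : bil n S S = 0 := by
      rw [← hR]
      simp only [bil_apply, S]
      congr 1
      · exact Finset.sum_congr rfl fun i _ => by
          linear_combination sgn i * r i ^ 2 * sgn_mul_sgn i
      · ring
    have hSe : bil n S (e, 0, 0) = 0 := by
      have : bil n S (e, 0, 0) = c * bil n (r, p, 0) (e, 0, 0) := by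
        simp only [bil_apply, S, mul_zero, add_zero, zero_div, sub_zero, Finset.mul_sum]
        exact Finset.sum_congr rfl fun i _ => by linear_combination sgn i * r i * he i
      rw [this, hRe, mul_zero]
    have hRS : bil n (r, p, 0) S ≠ 0 := by
      have h1 : bil n (r, p, 0) S = ∑ i, r i ^ 2 + |p| / 2 := by
        simp only [bil_apply, S, htp]
        rw [show ∑ i, sgn i * r i * (sgn i * r i) = ∑ i, r i ^ 2 from
          Finset.sum_congr rfl fun i _ => by linear_combination r i ^ 2 * sgn_mul_sgn i]
        ring
      rw [h1]
      intro h2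
      have h3 : 0 ≤ ∑ i, r i ^ 2 := Finset.sum_nonneg fun i _ => sq_nonneg _
      have h4 : p = 0 := by
        rw [← abs_eq_zero]
        linarith [abs_nonneg p]
      have h5 : ∑ i, r i ^ 2 = 0 := by linarith [abs_nonneg p]
      have h6 : r = 0 := by
        ext i
        simpa using (Finset.sum_eq_zero_iff_of_nonneg fun i _ => sq_nonneg (r i)).1 h5 i
          (Finset.mem_univ i)
      exact h0 (by simp [h4, h6])
    have hSN : bil n S (0, 1, 0) ≠ 0 := by simpa [bil_apply, S] using ht
    obtain ⟨φ, hφ, hφe, hφR⟩ := exists_isometry_null bil_comm hR hS hRe hSe hRS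
    obtain ⟨ψ, hψ, hψe, hψS⟩ := exists_isometry_null bil_comm hS hN hSe hNe hSN
    exact ⟨φ.trans ψ, fun x y => by simp [hψ, hφ], by simp [hφe, hψe], by simp [hφR, hψS]⟩
  · exact exists_isometry_null bil_comm hR hN hRe hNe (by simpa [bil_apply] using hq)

theorem autRel_of_toPair {n : ℕ} {x : F n} {e : Fin n → ℝ} {c : ℝ}
    (he : ∀ i, sgn i * e i = c * e i) {P R : (Fin n → ℝ) × ℝ × ℝ}
    (hx : PairRel (bil n) (toPair n x) (P, R)) (hP : bil n P P = bil n (e, 0, 0) (e, 0, 0))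
    (hP0 : bil n P P ≠ 0) (hPR : bil n P R = 0) (hR : bil n R R = 0) (hR0 : R ≠ 0) :
    AutRel x (1, 0, ((0 : ℝ), e), 0) := by
  obtain ⟨φ, hφ, hφP⟩ := exists_isometry_of_eq bil_comm hP hP0
  obtain ⟨ψ, hψ, hψe, hψR⟩ := exists_isometry_fixing he (R := φ R) (by rw [hφ, hR])
    (by rw [← hφP, hφ, bil_comm, hPR]) (by simpa using hR0)
  have h1 := hx.trans ((pairRel_isometry φ hφ P R).trans (pairRel_isometry ψ hψ _ _))
  rw [hφP, hψe, hψR] at h1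
  refine autRel_of_pairRel ?_
  convert h1 using 1
  simp [toPair_apply]
  rfl

end ConcreteModel

/-- every rank-3 element of `F^{2,n}` (`Δ(x) = 0` and `T(x) ≠ 0`) is
`Aut`-related to `x_{3a} = (1, 0, (0;1,0), 0)` or `x_{3b} = (1, 0, (0;0,1), 0)`. -/
theorem fts_rank3_orbits (n : ℕ) (hn : 2 ≤ n) (T : F n → F n) (hT : IsTripleMap T)
    (x : F n) (h1 : Dlt x = 0) (h2 : T x ≠ 0) :
    AutRel x (1, 0, ((0 : ℝ), vec2 1 0), 0) ∨
    AutRel x (1, 0, ((0 : ℝ), vec2 0 1), 0) := by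
  obtain ⟨P, R, hPR⟩ : ∃ P R, toPair n x = (P, R) := ⟨_, _, rfl⟩
  have hdet : gramDet (bil n) (P, R) = 0 := by
    rw [Dlt_eq_gramDet, hPR] at h1
    linarith
  have hgrad : ¬ (bil n R R • P = bil n P R • R ∧ bil n P P • R = bil n P R • P) := by
    rintro ⟨h3, h4⟩
    refine h2 (symp_nondegenerate fun z => ?_)
    rw [hT, deriv_Dlt x z hPR rfl, h3, h4]
    simp
  obtain ⟨P', R', hrel, hP, hPR', hR, hR0⟩ :=
    exists_pairRel_of_gramDet_eq_zero bil_comm hdet hgrad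
  rw [← hPR] at hrel
  rcases hP with hP | hP
  · left
    have he : bil n (vec2 1 0, 0, 0) (vec2 1 0, 0, 0) = 1 := by
      rw [bil_apply, Finset.sum_eq_single ⟨0, by omega⟩]
      · simp [sgn, vec2]
      · intro i _ hi
        have : (i : ℕ) ≠ 0 := fun h => hi (Fin.ext h)
        simp [vec2, this]
      · simp
    refine autRel_of_toPair (c := 1) (fun i => ?_) hrel (hP.trans he.symm) (by rw [hP]; norm_num)
      hPR' hR hR0
    by_cases hi : (i : ℕ) = 0 <;> simp [sgn, vec2, hi]
  · right
    have he : bil n (vec2 0 1, 0, 0) (vec2 0 1, 0, 0) = -1 := by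
      rw [bil_apply, Finset.sum_eq_single ⟨1, by omega⟩]
      · simp [sgn, vec2]
      · intro i _ hi
        have : (i : ℕ) ≠ 1 := fun h => hi (Fin.ext h)
        simp [vec2, this]
      · simp
    refine autRel_of_toPair (c := -1) (fun i => ?_) hrel (hP.trans he.symm)
      (by rw [hP]; norm_num) hPR' hR hR0
    by_cases hi : (i : ℕ) = 0 <;> simp [sgn, vec2, hi]
end
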